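/- arXiv:1411.4819 — 2 statements merged into one kernel-verified Lean document; each statement's English description precedes it below -/
import Mathlib

section
/- Let G be a 3-connected graph with n vertices and m edges satisfying m > 3n. Then the number of distinct K4-subdivisions contained in G is at least (m/6) · ((m/3)·(m/3 − 1)/2) · (m/n − 1/2), where the expression is evaluated over the real numbers. In particular, the minimum number of K4-subdivisions in 3-connected graphs with n vertices and m edges is Ω(m⁴/n). -/
open SimpleGraph

variable {V : Type*}

/-- A graph is `k`-connected if it has more than `k` vertices and no set of fewer than `k`
vertices whose deletion leaves a disconnected graph. -/
def IsKConnected [Fintype V] (k : ℕ) (G : SimpleGraph V) : Prop :=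
  k < Fintype.card V ∧
    ∀ S : Finset V, S.card < k → (G.induce ((↑S : Set V)ᶜ)).Connected

/-- `H` is a `K₄`-subdivision of `G` with branch ("real") vertices `b 0, b 1, b 2, b 3`:
there are six paths of length at least one in `G`, one between each pair of branch
vertices, whose union is `H`, such that any two of these paths intersect exactly in
their common endpoints (in particular they are internally disjoint from each other and
from the branch vertices). -/
def IsK4SubdivisionOn {G : SimpleGraph V} (H : G.Subgraph) (b : Fin 4 → V) : Prop :=
  Function.Injective b ∧
  ∃ P : ∀ p : Fin 4 × Fin 4, p.1 < p.2 → G.Walk (b p.1) (b p.2),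
    (∀ p h, (P p h).IsPath) ∧
    (∀ p h, 0 < (P p h).length) ∧
    (H = ⨆ (p : Fin 4 × Fin 4) (h : p.1 < p.2), (P p h).toSubgraph) ∧
    (∀ p q hp hq, p ≠ q → ∀ x, x ∈ (P p hp).support → x ∈ (P q hq).support →
      x ∈ ({b p.1, b p.2} ∩ {b q.1, b q.2} : Set V))

/-- `H` is a subgraph of `G` that is a `K₄`-subdivision. -/
def IsK4Subdivision {G : SimpleGraph V} (H : G.Subgraph) : Prop :=
  ∃ b, IsK4SubdivisionOn H b

/-- A circuit of a binary space `Z`: a nonzero element of minimal support. -/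
def IsCirc {E : Type*} (Z : Submodule (ZMod 2) (E → ZMod 2)) (c : E → ZMod 2) : Prop :=
  c ∈ Z ∧ c ≠ 0 ∧ ∀ w ∈ Z, w ≠ 0 → (∀ e, w e ≠ 0 → c e ≠ 0) → w = c

lemma zmod_two_add_ne {a b : ZMod 2} : a + b ≠ 0 ↔ (a ≠ 0 ∧ b = 0) ∨ (a = 0 ∧ b ≠ 0) := by
  revert a b; decide

lemma zmod_two_eq_of_ne {a b : ZMod 2} (h : a ≠ 0 ↔ b ≠ 0) : a = b := by
  revert a b; decide

lemma zmod_two_eq_one {a : ZMod 2} (h : a ≠ 0) : a = 1 := by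
  revert a; decide

lemma zmod_two_absurd {a b r : ZMod 2} (ha : a ≠ 0) (hb : b ≠ 0) (h1 : b ≠ 0 → a + b + r ≠ 0)
    (h2 : r ≠ 0 → a + b ≠ 0) : False := by
  obtain rfl := zmod_two_eq_one ha
  obtain rfl := zmod_two_eq_one hb
  have hab : (1 : ZMod 2) + 1 = 0 := CharTwo.add_self_eq_zero 1
  exact h2 (by simpa [hab] using h1) hab

lemma zmod_two_add_self_fun {E : Type*} (c : E → ZMod 2) : c + c = 0 := by
  funext e; exact CharTwo.add_self_eq_zero _

section

variable {E : Type*} {Z : Submodule (ZMod 2) (E → ZMod 2)}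

lemma exists_isCirc_of_ne [Finite E] {z : E → ZMod 2} (hz : z ∈ Z) {e : E} (he : z e ≠ 0) :
    ∃ c, IsCirc Z c ∧ c e ≠ 0 ∧ ∀ f, c f ≠ 0 → z f ≠ 0 := by
  classical
  have := Fintype.ofFinite E
  let S : Finset (E → ZMod 2) := Finset.univ.filter fun w =>
    w ∈ Z ∧ w e ≠ 0 ∧ ∀ f, w f ≠ 0 → z f ≠ 0
  obtain ⟨c, hcS, hmin⟩ := S.exists_min_image (fun w => (Finset.univ.filter fun f => w f ≠ 0).card)
    ⟨z, by simp [S, hz, he]⟩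
  simp only [S, Finset.mem_filter, Finset.mem_univ, true_and] at hcS hmin
  obtain ⟨hcZ, hce, hcz⟩ := hcS
  refine ⟨c, ⟨hcZ, fun h => hce (by simp [h]), fun w hw hw0 hwc => ?_⟩, hce, hcz⟩
  by_contra hne
  -- one of `w`, `c + w` contains `e` and has smaller support
  have key : ∀ u ∈ Z, u e ≠ 0 → (∀ f, u f ≠ 0 → c f ≠ 0) → u = c := by
    intro u hu hue huc
    have h1 := hmin u ⟨hu, hue, fun f hf => hcz f (huc f hf)⟩
    have h2 : (Finset.univ.filter fun f => u f ≠ 0) = Finset.univ.filter fun f => c f ≠ 0 :=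
      Finset.eq_of_subset_of_card_le (fun f => by simpa using huc f) h1
    funext f
    have := Finset.ext_iff.1 h2 f
    simp only [Finset.mem_filter, Finset.mem_univ, true_and] at this
    exact zmod_two_eq_of_ne this
  by_cases hwe : w e = 0
  · have := key (c + w) (Z.add_mem hcZ hw) (by simpa [hwe] using hce) (fun f hf => by
      rcases zmod_two_add_ne.1 hf with h | h
      · exact h.1
      · exact hwc f h.2)
    exact hw0 (by simpa using this)
  · exact hne (key w hw hwe hwc)

lemma IsCirc.eq_of_subset {c d : E → ZMod 2} (hc : IsCirc Z c) (hd : IsCirc Z d)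
    (h : ∀ e, d e ≠ 0 → c e ≠ 0) : d = c :=
  hc.2.2 d hd.1 hd.2.1 h

lemma IsCirc.exists_ne {c d : E → ZMod 2} (hc : IsCirc Z c) (hd : IsCirc Z d) (h : d ≠ c) :
    ∃ e, d e ≠ 0 ∧ c e = 0 := by
  by_contra! hh
  exact h (hc.eq_of_subset hd fun e he => hh e he)

lemma isCirc_trans [Finite E] {e f g : E} {c₁ c₂ : E → ZMod 2}
    (h₁ : IsCirc Z c₁) (h₂ : IsCirc Z c₂) (he : c₁ e ≠ 0) (hf₁ : c₁ f ≠ 0) (hf₂ : c₂ f ≠ 0)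
    (hg : c₂ g ≠ 0) : ∃ c, IsCirc Z c ∧ c e ≠ 0 ∧ c g ≠ 0 := by
  classical
  have := Fintype.ofFinite E
  by_contra hno
  push Not at hno
  let S : Finset ((E → ZMod 2) × (E → ZMod 2)) := Finset.univ.filter fun p =>
    IsCirc Z p.1 ∧ IsCirc Z p.2 ∧ p.1 e ≠ 0 ∧ p.2 g ≠ 0 ∧ ∃ f, p.1 f ≠ 0 ∧ p.2 f ≠ 0
  obtain ⟨⟨c, d⟩, hS, hmin⟩ := S.exists_min_image
    (fun p => (Finset.univ.filter fun f => p.1 f ≠ 0 ∨ p.2 f ≠ 0).card)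
    ⟨(c₁, c₂), by simpa [S, h₁, h₂, he, hg] using ⟨f, hf₁, hf₂⟩⟩
  simp only [S, Finset.mem_filter, Finset.mem_univ, true_and, Prod.forall] at hS hmin
  obtain ⟨hc, hd, hce, hdg, f₀, hcf, hdf⟩ := hS
  have hde : d e = 0 := by
    by_contra h; exact h (by_contra fun h' => hdg (hno d hd h'))
  have hcg : c g = 0 := hno c hc hce
  have hs : c + d ∈ Z := Z.add_mem hc.1 hd.1
  obtain ⟨x, hx, hxe, hxs⟩ := exists_isCirc_of_ne (z := c + d) (e := e) hs (by simpa [hde] using hce)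
  obtain ⟨y, hy, hyg, hys⟩ := exists_isCirc_of_ne (z := c + d + x) (e := g) (Z.add_mem hs hx.1)
    (by simpa [hcg, hno x hx hxe] using hdg)
  simp only [Pi.add_apply] at hxs hys
  have hne_x : x ≠ c := fun h => by
    have := hxs f₀; rw [h] at this
    rcases zmod_two_add_ne.1 (this hcf) with h | h <;> tauto
  obtain ⟨p, hp, hpc⟩ := hc.exists_ne hx hne_x
  have hpd : d p ≠ 0 := by
    rcases zmod_two_add_ne.1 (hxs p hp) with h | h <;> tauto
  have hle := hmin x d ⟨hx, hd, hxe, hdg, p, hp, hpd⟩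
  have hsub : (Finset.univ.filter fun f => x f ≠ 0 ∨ d f ≠ 0) ⊆
      Finset.univ.filter fun f => c f ≠ 0 ∨ d f ≠ 0 := by
    intro q
    simp only [Finset.mem_filter, Finset.mem_univ, true_and]
    rintro (h | h)
    · rcases zmod_two_add_ne.1 (hxs q h) with h | h <;> tauto
    · exact Or.inr h
  have heq := Finset.ext_iff.1 (Finset.eq_of_subset_of_card_le hsub hle)
  simp only [Finset.mem_filter, Finset.mem_univ, true_and] at heq
  -- every element of `c \ d` lies in `x`, so `y` lies inside `d`
  have hyd : y = d := hd.eq_of_subset hy fun q hq => by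
    by_contra hdq
    have h1 := hys q hq
    have h2 := heq q
    have h3 := hxs q
    revert h1 h2 h3 hdq
    generalize c q = a; generalize d q = b; generalize x q = r
    revert a b r; decide
  have h1 := hys f₀
  have h2 := hxs f₀
  rw [hyd] at h1
  exact zmod_two_absurd hcf hdf h1 h2


/-- If `f` is a circuit meeting the circuit `c` such that `f \ c` is minimal,
then `c + f` is a circuit. -/
lemma IsCirc.add_of_minimal {c f : E → ZMod 2} (hc : IsCirc Z c) (hf : IsCirc Z f)
    (hcf : ∃ e, c e ≠ 0 ∧ f e ≠ 0) (hne : f ≠ c)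
    (hmin : ∀ w ∈ Z, (∃ e, w e ≠ 0 ∧ c e = 0) → (∀ e, w e ≠ 0 → c e = 0 → f e ≠ 0) →
      ∀ e, f e ≠ 0 → c e = 0 → w e ≠ 0) :
    IsCirc Z (c + f) := by
  have hs : c + f ∈ Z := Z.add_mem hc.1 hf.1
  refine ⟨hs, fun h => hne ?_, fun w hw hw0 hws => ?_⟩
  · rw [← add_zero f, ← zmod_two_add_self_fun c, ← add_assoc, add_comm f c, h, zero_add]
  simp only [Pi.add_apply] at hws
  obtain ⟨e₀, hce₀, hfe₀⟩ := hcf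
  by_cases hwc : ∀ e, w e ≠ 0 → c e ≠ 0
  · have := hc.2.2 w hw hw0 hwc
    rw [this] at hws
    rcases zmod_two_add_ne.1 (hws e₀ hce₀) with h | h <;> tauto
  push Not at hwc
  have h1 := hmin w hw hwc fun e he hce => by
    rcases zmod_two_add_ne.1 (hws e he) with h | h <;> tauto
  by_contra hwne
  have h2 := hc.2.2 (c + f + w) (Z.add_mem hs hw) (fun h => hwne ?_) fun e he => ?_
  · have h3 := congrFun h2 e₀
    have h4 := hws e₀
    simp only [Pi.add_apply] at h3
    generalize c e₀ = a at *; generalize f e₀ = b at *; generalize w e₀ = r at *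
    obtain rfl := zmod_two_eq_one hce₀
    obtain rfl := zmod_two_eq_one hfe₀
    revert r; decide
  · rw [← add_zero w, ← h, add_comm (c + f) w, ← add_assoc, zmod_two_add_self_fun, zero_add]
  · have h4 := h1 e
    have h5 := hws e
    simp only [Pi.add_apply] at he
    generalize c e = a at *; generalize f e = b at *; generalize w e = r at *
    rintro rfl
    by_cases hb : b = 0
    · subst hb
      by_cases hr : r = 0
      · simp [hr] at he
      · simpa using h5 hr
    · have hr := h4 hb rfl
      clear h4 h5 h1
      revert b r; decide

/-- Let `c` and `d` be disjoint circuits such that `c`, `d` are the only circuits in `c ∪ d`.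
If `g` is a circuit meeting both with `g \ (c ∪ d)` minimal, then `c + g` is a circuit. -/
lemma IsCirc.add_of_connecting [Finite E] {c d g : E → ZMod 2} (hd : IsCirc Z d)
    (hc : IsCirc Z c) (hg : IsCirc Z g) (hcd : ∀ e, c e ≠ 0 → d e = 0)
    (hM : ∀ w ∈ Z, (∀ e, w e ≠ 0 → c e ≠ 0 ∨ d e ≠ 0) → w = 0 ∨ w = c ∨ w = d ∨ w = c + d)
    (hgc : ∃ e, c e ≠ 0 ∧ g e ≠ 0) (hgd : ∃ e, d e ≠ 0 ∧ g e ≠ 0)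
    (hmin : ∀ x, IsCirc Z x → (∃ e, c e ≠ 0 ∧ x e ≠ 0) → (∃ e, d e ≠ 0 ∧ x e ≠ 0) →
      (∀ e, x e ≠ 0 → c e ≠ 0 ∨ d e ≠ 0 ∨ g e ≠ 0) →
      ∀ e, g e ≠ 0 → c e ≠ 0 ∨ d e ≠ 0 ∨ x e ≠ 0) :
    IsCirc Z (c + g) := by
  have hs : c + g ∈ Z := Z.add_mem hc.1 hg.1
  obtain ⟨a, hca, hga⟩ := hgc
  obtain ⟨b, hdb, hgb⟩ := hgd
  have hcb : c b = 0 := by by_contra h; exact hdb (hcd b h)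
  obtain ⟨x, hx, hxb, hxs⟩ := exists_isCirc_of_ne (e := b) hs (by simpa [hcb] using hgb)
  simp only [Pi.add_apply] at hxs
  have hxc : ∃ e, c e ≠ 0 ∧ x e ≠ 0 := by
    by_contra! h
    have : x = g := hg.eq_of_subset hx fun e he => by
      rcases zmod_two_add_ne.1 (hxs e he) with h' | h'
      · exact absurd (h e h'.1) he
      · exact h'.2
    exact hga (this ▸ h a hca)
  have hO := hmin x hx hxc ⟨b, hdb, hxb⟩ fun e he => by
    rcases zmod_two_add_ne.1 (hxs e he) with h' | h' <;> tauto
  have hdg : ¬ ∀ e, d e ≠ 0 → g e ≠ 0 := fun h => by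
    have := hg.eq_of_subset hd h
    exact hga (this ▸ hcd a hca)
  have hy : ∀ e, (c + g + x) e ≠ 0 → c e + g e ≠ 0 ∧ x e = 0 := by
    intro e he
    have := hxs e
    simp only [Pi.add_apply] at he
    generalize c e + g e = p at *; generalize x e = q at *
    clear hO hxs hx hxc hxb hgb hcb hmin hga
    revert p q; decide
  have hsub : ∀ e, (c + g + x) e ≠ 0 → c e ≠ 0 ∨ d e ≠ 0 := fun e he => by
    obtain ⟨h1, h2⟩ := hy e he
    rcases zmod_two_add_ne.1 h1 with h' | h'
    · exact Or.inl h'.1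
    · rcases hO e h'.2 with h | h | h <;> tauto
  rcases hM _ (Z.add_mem hs hx.1) hsub with h | h | h | h
  · have : x = c + g := by
      rw [← add_zero x, ← h, add_comm (c + g) x, ← add_assoc, zmod_two_add_self_fun, zero_add]
    exact this ▸ hx
  · have := (hy a (by rw [h]; exact hca)).1
    rcases zmod_two_add_ne.1 this with h' | h' <;> tauto
  · refine absurd (fun e he => ?_) hdg
    have hce : c e = 0 := by by_contra h'; exact he (hcd e h')
    have := (hy e (by rw [h]; exact he)).1
    simpa [hce] using this
  · refine absurd (fun e he => ?_) hdg
    have hce : c e = 0 := by by_contra h'; exact he (hcd e h')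
    have := (hy e (by rw [h]; simpa [hce] using he)).1
    simpa [hce] using this

open Classical in
/-- If any two elements lie in a common circuit and a quadratic function vanishes on all circuits,
then its polarization vanishes whenever one argument is a circuit. -/
lemma polar_eq_zero_of_isCirc [Finite E] (hconn : ∀ e f, (∃ c, IsCirc Z c ∧ c e ≠ 0) →
      (∃ c, IsCirc Z c ∧ c f ≠ 0) → ∃ c, IsCirc Z c ∧ c e ≠ 0 ∧ c f ≠ 0)
    (β : LinearMap.BilinForm (ZMod 2) (E → ZMod 2)) (hβ : ∀ c, IsCirc Z c → β c c = 0)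
    {c : E → ZMod 2} (hc : IsCirc Z c) {z : E → ZMod 2} (hz : z ∈ Z) : β c z + β z c = 0 := by
  have := Fintype.ofFinite E
  have hpair : ∀ x y, IsCirc Z x → IsCirc Z y → IsCirc Z (x + y) → β x y + β y x = 0 := by
    intro x y hx hy hxy
    have := hβ _ hxy
    simpa [hβ x hx, hβ y hy, add_comm] using this
  by_contra hne
  let S : Finset (E → ZMod 2) := Finset.univ.filter fun w => w ∈ Z ∧ β c w + β w c ≠ 0
  obtain ⟨z, hzS, hmin⟩ := S.exists_min_image
    (fun w => (Finset.univ.filter fun e => w e ≠ 0 ∧ c e = 0).card) ⟨z, by simp [S, hz, hne]⟩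
  simp only [S, Finset.mem_filter, Finset.mem_univ, true_and] at hzS hmin
  clear hne hz
  obtain ⟨hz, hne⟩ := hzS
  -- `z \ c` is minimal
  have hM₀ : ∀ w ∈ Z, (∃ e, w e ≠ 0 ∧ c e = 0) → (∀ e, w e ≠ 0 → c e = 0 → z e ≠ 0) →
      ∀ e, z e ≠ 0 → c e = 0 → w e ≠ 0 := by
    intro w hw ⟨a, hwa, hca⟩ hwz
    by_contra! h
    obtain ⟨b, hzb, hcb, hwb⟩ := h
    have hlt : ∀ u, (∀ e, u e ≠ 0 → c e = 0 → z e ≠ 0) → (∃ e, c e = 0 ∧ z e ≠ 0 ∧ u e = 0) →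
        u ∈ Z → β c u + β u c = 0 := by
      intro u hu ⟨e, hce, hze, hue⟩ huZ
      by_contra hu'
      refine absurd (hmin u ⟨huZ, hu'⟩) (not_le.2 (Finset.card_lt_card ?_))
      refine Finset.ssubset_iff_subset_ne.2 ⟨fun q => ?_, fun h => ?_⟩
      · simp only [Finset.mem_filter, Finset.mem_univ, true_and]
        exact fun ⟨h1, h2⟩ => ⟨hu q h1 h2, h2⟩
      · have := Finset.ext_iff.1 h e
        simp [hce, hze, hue] at this
    have h1 := hlt w hwz ⟨b, hcb, hzb, hwb⟩ hw
    have h2 := hlt (z + w) (fun e he hce => by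
      rcases zmod_two_add_ne.1 he with h | h
      · exact h.1
      · exact hwz e h.2 hce) ⟨a, hca, hwz a hwa hca, by
        have := hwz a hwa hca
        simp only [Pi.add_apply]
        generalize z a = p at *; generalize w a = q at *
        clear hlt h1 hwb
        revert p q; decide⟩ (Z.add_mem hz hw)
    apply hne
    have h3 : β c (z + w) + β (z + w) c = (β c z + β z c) + (β c w + β w c) := by
      simp; ring
    rw [h3, h1, add_zero] at h2
    exact h2
  have hzc : ∃ e, z e ≠ 0 ∧ c e = 0 := by
    by_contra! h
    by_cases hz0 : z = 0
    · simp [hz0] at hne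
    · exact hne (by rw [hc.2.2 z hz hz0 h]; exact CharTwo.add_self_eq_zero _)
  obtain ⟨a, hza, hca⟩ := hzc
  obtain ⟨d, hd, hda, hdz⟩ := exists_isCirc_of_ne hz hza
  have hzd := hM₀ d hd.1 ⟨a, hda, hca⟩ fun e he _ => hdz e he
  have hdne : β c d + β d c ≠ 0 := by
    intro h0
    have hsub : ∀ e, (z + d) e ≠ 0 → c e ≠ 0 := by
      intro e he hce
      have h1 := hdz e
      have h2 := fun h => hzd e h hce
      rcases zmod_two_add_ne.1 he with h | h <;> tauto
    have h3 : β c (z + d) + β (z + d) c = (β c z + β z c) + (β c d + β d c) := by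
      simp; ring
    rw [h0, add_zero] at h3
    by_cases hz0 : z + d = 0
    · simp [hz0] at h3; exact hne h3.symm
    · rw [hc.2.2 _ (Z.add_mem hz hd.1) hz0 hsub] at h3
      rw [CharTwo.add_self_eq_zero] at h3
      exact hne h3.symm
  have hM₁ : ∀ w ∈ Z, (∃ e, w e ≠ 0 ∧ c e = 0) → (∀ e, w e ≠ 0 → c e = 0 → d e ≠ 0) →
      ∀ e, d e ≠ 0 → c e = 0 → w e ≠ 0 := fun w hw h1 h2 e hde hce =>
    hM₀ w hw h1 (fun e he hce => hdz e (h2 e he hce)) e (hdz e hde) hce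
  have hcd : ∀ e, c e ≠ 0 → d e = 0 := by
    by_contra! h
    exact hdne (hpair c d hc hd (hc.add_of_minimal hd h (fun h => hda (h ▸ hca)) hM₁))
  have hM : ∀ w ∈ Z, (∀ e, w e ≠ 0 → c e ≠ 0 ∨ d e ≠ 0) →
      w = 0 ∨ w = c ∨ w = d ∨ w = c + d := by
    intro w hw hwcd
    have hin : ∀ w ∈ Z, (∀ e, w e ≠ 0 → c e ≠ 0) → w = 0 ∨ w = c := fun w hw h => by
      by_cases h0 : w = 0
      · exact Or.inl h0
      · exact Or.inr (hc.2.2 w hw h0 h)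
    by_cases h : ∀ e, w e ≠ 0 → c e ≠ 0
    · rcases hin w hw h with h | h <;> tauto
    · push Not at h
      have h1 := hM₁ w hw h fun e he hce => (hwcd e he).resolve_left (by simp [hce])
      have h2 := hin (w + d) (Z.add_mem hw hd.1) fun e he hce => by
        have h3 := hwcd e
        have h4 := fun h => h1 e h hce
        rcases zmod_two_add_ne.1 he with h | h <;> tauto
      have h5 : w = (w + d) + d := by rw [add_assoc, zmod_two_add_self_fun, add_zero]
      rcases h2 with h2 | h2 <;> rw [h2] at h5
      · rw [zero_add] at h5; tauto
      · tauto
  obtain ⟨c₀, hcc₀⟩ : ∃ e, c e ≠ 0 := Function.ne_iff.1 hc.2.1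
  obtain ⟨g₀, hg₀, hgc₀, hgd₀⟩ := hconn c₀ a ⟨c, hc, hcc₀⟩ ⟨d, hd, hda⟩
  let T : Finset (E → ZMod 2) := Finset.univ.filter fun g =>
    IsCirc Z g ∧ (∃ e, c e ≠ 0 ∧ g e ≠ 0) ∧ ∃ e, d e ≠ 0 ∧ g e ≠ 0
  obtain ⟨g, hgT, hgmin⟩ := T.exists_min_image
    (fun w => (Finset.univ.filter fun e => w e ≠ 0 ∧ c e = 0 ∧ d e = 0).card)
    ⟨g₀, by simpa [T, hg₀] using ⟨⟨c₀, hcc₀, hgc₀⟩, ⟨a, hda, hgd₀⟩⟩⟩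
  simp only [T, Finset.mem_filter, Finset.mem_univ, true_and] at hgT hgmin
  obtain ⟨hg, hgc, hgd⟩ := hgT
  have hmin' : ∀ x, IsCirc Z x → (∃ e, c e ≠ 0 ∧ x e ≠ 0) → (∃ e, d e ≠ 0 ∧ x e ≠ 0) →
      (∀ e, x e ≠ 0 → c e ≠ 0 ∨ d e ≠ 0 ∨ g e ≠ 0) →
      ∀ e, g e ≠ 0 → c e ≠ 0 ∨ d e ≠ 0 ∨ x e ≠ 0 := by
    intro x hx hxc hxd hxg e hge
    have h1 := hgmin x ⟨hx, hxc, hxd⟩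
    have h2 := Finset.ext_iff.1 (Finset.eq_of_subset_of_card_le (fun e => by
      simp only [Finset.mem_filter, Finset.mem_univ, true_and]
      have := hxg e
      tauto) h1) e
    simp only [Finset.mem_filter, Finset.mem_univ, true_and] at h2
    tauto
  have hdc : ∀ e, d e ≠ 0 → c e = 0 := fun e he => by by_contra h; exact he (hcd e h)
  have hM' : ∀ w ∈ Z, (∀ e, w e ≠ 0 → d e ≠ 0 ∨ c e ≠ 0) →
      w = 0 ∨ w = d ∨ w = c ∨ w = d + c := fun w hw h => by
    rw [add_comm d c]
    have := hM w hw fun e he => (h e he).symm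
    tauto
  have hcg : IsCirc Z (c + g) := hd.add_of_connecting hc hg hcd hM hgc hgd hmin'
  have hdg : IsCirc Z (d + g) := hc.add_of_connecting hd hg hdc hM' hgd hgc
    fun x hx h1 h2 h3 e he => by
      have := hmin' x hx h2 h1 (fun e he => by have := h3 e he; tauto) e he
      tauto
  have hgne : g ≠ c := fun h => by
    obtain ⟨e, h1, h2⟩ := hgd
    exact h1 (hcd e (h ▸ h2))
  have hdcg : IsCirc Z (d + (c + g)) := by
    refine hc.add_of_connecting hd hcg hdc hM' ?_ ?_ ?_
    · obtain ⟨e, h1, h2⟩ := hgd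
      exact ⟨e, h1, by simpa [hdc e h1] using h2⟩
    · obtain ⟨e, h1, h2⟩ := hg.exists_ne hc hgne.symm
      exact ⟨e, h1, by simpa [h2] using h1⟩
    · intro x hx h1 h2 h3 e he
      have h4 := hmin' x hx h2 h1 fun e he => by
        rcases h3 e he with h | h | h
        · tauto
        · tauto
        · rcases zmod_two_add_ne.1 h with h | h <;> tauto
      rcases zmod_two_add_ne.1 he with h | h
      · tauto
      · have := h4 e h.2
        tauto
  have e1 := hpair d g hd hg hdg
  have e2 := hpair d (c + g) hd hcg hdcg
  apply hdne
  have e3 : β d (c + g) + β (c + g) d = (β c d + β d c) + (β d g + β g d) := by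
    simp; ring
  rw [e3, e1, add_zero] at e2
  exact e2

open Classical in
lemma quadratic_eq_zero_of_isCirc [Finite E] (hconn : ∀ e f, (∃ c, IsCirc Z c ∧ c e ≠ 0) →
      (∃ c, IsCirc Z c ∧ c f ≠ 0) → ∃ c, IsCirc Z c ∧ c e ≠ 0 ∧ c f ≠ 0)
    (β : LinearMap.BilinForm (ZMod 2) (E → ZMod 2)) (hβ : ∀ c, IsCirc Z c → β c c = 0)
    {z : E → ZMod 2} (hz : z ∈ Z) : β z z = 0 := by
  have := Fintype.ofFinite E
  induction hn : (Finset.univ.filter fun e => z e ≠ 0).card using Nat.strong_induction_on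
    generalizing z with
  | _ n ih =>
    by_cases hz0 : z = 0
    · simp [hz0]
    obtain ⟨a, ha⟩ := Function.ne_iff.1 hz0
    obtain ⟨c, hc, hca, hcz⟩ := exists_isCirc_of_ne hz ha
    have hw := Z.add_mem hc.1 hz
    have h1 := ih _ (by
      rw [← hn]
      refine Finset.card_lt_card (Finset.ssubset_iff_subset_ne.2 ⟨fun q => ?_, fun h => ?_⟩)
      · simp only [Finset.mem_filter, Finset.mem_univ, true_and]
        intro h
        rcases zmod_two_add_ne.1 h with h | h
        · exact hcz q h.1
        · exact h.2
      · have h2 := (Finset.ext_iff.1 h a).2 (by simpa using ha)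
        simp only [Finset.mem_filter, Finset.mem_univ, true_and] at h2
        rcases zmod_two_add_ne.1 h2 with h | h <;> simp_all) hw rfl
    have h2 := polar_eq_zero_of_isCirc hconn β hβ hc hw
    have h3 : z = c + (c + z) := by rw [← add_assoc, zmod_two_add_self_fun, zero_add]
    have h4 : β z z = β c c + β (c + z) (c + z) + (β c (c + z) + β (c + z) c) := by
      conv_lhs => rw [h3]
      simp only [map_add, LinearMap.add_apply]; ring
    rw [h4, h1, h2, hβ c hc]; simp

/-- A connected binary space of dimension `μ` has at least `(μ + 1).choose 2` circuits. -/
lemma choose_le_ncard_isCirc [Finite E] (hconn : ∀ e f, (∃ c, IsCirc Z c ∧ c e ≠ 0) →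
      (∃ c, IsCirc Z c ∧ c f ≠ 0) → ∃ c, IsCirc Z c ∧ c e ≠ 0 ∧ c f ≠ 0) :
    (Module.finrank (ZMod 2) Z + 1).choose 2 ≤ {c | IsCirc Z c}.ncard := by
  classical
  have := Fintype.ofFinite E
  set μ := Module.finrank (ZMod 2) Z
  let b := Module.finBasis (ZMod 2) Z
  obtain ⟨π, hπ⟩ := LinearMap.exists_leftInverse_of_injective Z.subtype (by simp)
  have hπ' : ∀ z : Z, π z = z := fun z => LinearMap.congr_fun hπ z
  let A : (Sym2 (Fin μ) → ZMod 2) → Matrix (Fin μ) (Fin μ) (ZMod 2) :=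
    fun a => Matrix.of fun i j => if i ≤ j then a s(i, j) else 0
  let β : (Sym2 (Fin μ) → ZMod 2) → LinearMap.BilinForm (ZMod 2) (E → ZMod 2) :=
    fun a => (Matrix.toBilin b (A a)).comp π π
  have hβ : ∀ a z w, β a z w =
      ∑ i, ∑ j, b.repr (π z) i * (if i ≤ j then a s(i, j) else 0) * b.repr (π w) j := by
    intro a z w
    simp [β, A, Matrix.toBilin_apply]
  let Φ : (Sym2 (Fin μ) → ZMod 2) →ₗ[ZMod 2] ({c | IsCirc Z c} → ZMod 2) :=
    { toFun := fun a c => β a c c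
      map_add' := fun a a' => by
        funext c
        simp only [hβ, Pi.add_apply, ← Finset.sum_add_distrib]
        refine Finset.sum_congr rfl fun i _ => Finset.sum_congr rfl fun j _ => ?_
        split_ifs <;> ring
      map_smul' := fun r a => by
        funext c
        simp only [hβ, Pi.smul_apply, smul_eq_mul, Finset.mul_sum, RingHom.id_apply]
        refine Finset.sum_congr rfl fun i _ => Finset.sum_congr rfl fun j _ => ?_
        split_ifs <;> ring }
  have hinj : Function.Injective Φ := by
    rw [← LinearMap.ker_eq_bot, LinearMap.ker_eq_bot']
    intro a ha
    have h0 : ∀ z ∈ Z, β a z z = 0 := fun z hz =>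
      quadratic_eq_zero_of_isCirc hconn (β a) (fun c hc => congrFun ha ⟨c, hc⟩) hz
    have hb : ∀ i j, β a (b i) (b j) = if i ≤ j then a s(i, j) else 0 := by
      intro i j
      rw [hβ, hπ', hπ', Finset.sum_eq_single i, Finset.sum_eq_single j]
      · simp
      · intro k _ hk; simp [hk.symm]
      · simp
      · intro k _ hk; simp [Finsupp.single_apply, hk.symm]
      · simp
    have hd : ∀ i, a s(i, i) = 0 := fun i => by
      have := h0 _ (b i).2
      rw [hb] at this; simpa using this
    funext p
    induction p using Sym2.ind with
    | _ i j =>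
      have h1 := h0 _ (b i + b j).2
      rcases lt_trichotomy i j with h | h | h
      · simpa [hb, hd, h.le, not_le.2 h] using h1
      · subst h; exact hd i
      · rw [Sym2.eq_swap]
        simpa [hb, hd, h.le, not_le.2 h] using h1
  have := LinearMap.finrank_le_finrank_of_injective hinj
  rw [Module.finrank_fintype_fun_eq_card, Module.finrank_fintype_fun_eq_card, Sym2.card,
    Fintype.card_fin] at this
  rwa [← Nat.card_eq_fintype_card, Nat.card_coe_set_eq] at this

end

section CycleSpace

variable {V : Type*} {H : SimpleGraph V}

open Classical in
/-- The sum of the edges of a walk. -/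
noncomputable def walkChain {a b : V} (p : H.Walk a b) : H.edgeSet → ZMod 2 :=
  fun e => (p.edges.count (e : Sym2 V) : ZMod 2)

open Classical in
lemma walkChain_cons {a b c : V} (h : H.Adj a b) (p : H.Walk b c) :
    walkChain (SimpleGraph.Walk.cons h p) = Pi.single ⟨s(a, b), h⟩ 1 + walkChain p := by
  funext e
  simp only [walkChain, SimpleGraph.Walk.edges_cons, List.count_cons, Pi.add_apply, Pi.single_apply,
    Nat.cast_add, beq_iff_eq]
  rw [add_comm]
  congr 1
  by_cases he : e = ⟨s(a, b), h⟩
  · subst he; simp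
  · have : ¬ s(a, b) = (e : Sym2 V) := fun h' => he (Subtype.ext h'.symm)
    simp [this, he]

lemma mem_edges_of_walkChain_ne {a b : V} {p : H.Walk a b} {e : H.edgeSet}
    (h : walkChain p e ≠ 0) : (e : Sym2 V) ∈ p.edges := by
  classical
  by_contra h'
  exact h (by simp [walkChain, List.count_eq_zero.2 h'])

variable [Fintype V]

open Classical in
variable (H) in
/-- The boundary map of `H` over `ZMod 2`. -/
noncomputable def edgeBoundary : (H.edgeSet → ZMod 2) →ₗ[ZMod 2] (V → ZMod 2) where
  toFun z u := ∑ e : H.edgeSet, if u ∈ (e : Sym2 V) then z e else 0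
  map_add' z w := by
    funext u
    simp only [Pi.add_apply, ← Finset.sum_add_distrib]
    exact Finset.sum_congr rfl fun e _ => by split_ifs <;> simp
  map_smul' r z := by
    funext u
    simp only [Pi.smul_apply, smul_eq_mul, Finset.mul_sum, RingHom.id_apply]
    exact Finset.sum_congr rfl fun e _ => by split_ifs <;> simp

variable (H) in
/-- The cycle space of `H` over `ZMod 2`. -/
noncomputable def cycleSpace : Submodule (ZMod 2) (H.edgeSet → ZMod 2) :=
  LinearMap.ker (edgeBoundary H)

variable (H) in
lemma ncard_edgeSet_le_finrank_cycleSpace :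
    H.edgeSet.ncard ≤ Module.finrank (ZMod 2) (cycleSpace H) + Fintype.card V := by
  classical
  have h1 := (edgeBoundary H).finrank_range_add_finrank_ker
  have h2 := (LinearMap.range (edgeBoundary H)).finrank_le
  rw [Module.finrank_fintype_fun_eq_card] at h1 h2
  rw [← Nat.card_eq_fintype_card, Nat.card_coe_set_eq] at h1
  unfold cycleSpace
  omega

open Classical in
lemma edgeBoundary_single (e : H.edgeSet) (u : V) :
    edgeBoundary H (Pi.single e 1) u = if u ∈ (e : Sym2 V) then 1 else 0 := by
  show ∑ f : H.edgeSet, (if u ∈ (f : Sym2 V) then (Pi.single e 1 : H.edgeSet → ZMod 2) f else 0) = _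
  rw [Finset.sum_eq_single e]
  · simp
  · intro f _ hf; simp [hf]
  · simp

open Classical in
lemma edgeBoundary_walkChain {a b : V} (p : H.Walk a b) (u : V) :
    edgeBoundary H (walkChain p) u = (if u = a then 1 else 0) + (if u = b then 1 else 0) := by
  induction p with
  | @nil a =>
    have : walkChain (SimpleGraph.Walk.nil : H.Walk a a) = 0 := by funext e; simp [walkChain]
    rw [this, map_zero, CharTwo.add_self_eq_zero]; rfl
  | @cons a c b h p ih =>
    rw [walkChain_cons, map_add, Pi.add_apply, ih, edgeBoundary_single]
    have hne := h.ne
    by_cases h1 : u = a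
    · subst h1
      simp [hne]
    · by_cases h2 : u = c
      · subst h2
        rw [← add_assoc]
        simp [h1]
        exact CharTwo.add_self_eq_zero _
      · simp [h1, h2]

lemma walkChain_mem_cycleSpace {a : V} (p : H.Walk a a) : walkChain p ∈ cycleSpace H := by
  classical
  refine LinearMap.mem_ker.2 ?_
  funext u
  rw [edgeBoundary_walkChain, CharTwo.add_self_eq_zero]; rfl

/-- An element of the cycle space has no vertex of degree one. -/
lemma exists_ne_of_mem_cycleSpace {z : H.edgeSet → ZMod 2} (hz : z ∈ cycleSpace H) {u : V}
    {e : H.edgeSet} (hu : u ∈ (e : Sym2 V)) (he : z e ≠ 0) :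
    ∃ f : H.edgeSet, f ≠ e ∧ u ∈ (f : Sym2 V) ∧ z f ≠ 0 := by
  classical
  by_contra! h
  have h1 := congrFun (LinearMap.mem_ker.1 hz) u
  have h2 : ∑ f : H.edgeSet, (if u ∈ (f : Sym2 V) then z f else 0) = 0 := h1
  rw [Finset.sum_eq_single e] at h2
  · simp [hu] at h2; exact he h2
  · intro f _ hf
    split_ifs with hm
    · exact h f hf hm
    · rfl
  · simp

lemma exists_isCycle_of_mem_cycleSpace {z : H.edgeSet → ZMod 2} (hz : z ∈ cycleSpace H)
    (h0 : z ≠ 0) : ∃ (u : V) (p : H.Walk u u), p.IsCycle ∧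
      ∀ e : H.edgeSet, (e : Sym2 V) ∈ p.edges → z e ≠ 0 := by
  classical
  let S : SimpleGraph V := SimpleGraph.fromEdgeSet {e | ∃ h : e ∈ H.edgeSet, z ⟨e, h⟩ ≠ 0}
  have hSH : S ≤ H := by
    intro a b hab
    obtain ⟨h, -⟩ := ((SimpleGraph.fromEdgeSet_adj _).1 hab).1
    exact h
  have hSz : ∀ e : H.edgeSet, (e : Sym2 V) ∈ S.edgeSet → z e ≠ 0 := by
    rintro ⟨e, he⟩ h
    rw [SimpleGraph.edgeSet_fromEdgeSet] at h
    exact h.1.2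
  have hzS : ∀ e : H.edgeSet, z e ≠ 0 → (e : Sym2 V) ∈ S.edgeSet := by
    rintro ⟨e, he⟩ h
    rw [SimpleGraph.edgeSet_fromEdgeSet]
    exact ⟨⟨he, h⟩, fun hd => H.not_isDiag_of_mem_edgeSet he (by simpa using hd)⟩
  have hac : ¬ S.IsAcyclic := by
    intro hac
    obtain ⟨⟨e, he⟩, hze⟩ := Function.ne_iff.1 h0
    have heS := hzS _ hze
    induction e using Sym2.ind with
    | _ a b =>
      have := Nonempty.intro a
      obtain ⟨u, v, p, hp, hmax⟩ := SimpleGraph.Walk.exists_isPath_forall_isPath_length_le_length S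
      have hab : S.Adj a b := heS
      have hl := hmax a b hab.toWalk (SimpleGraph.Walk.IsPath.of_adj hab)
      cases p with
      | nil => simp at hl
      | @cons _ w _ h q =>
        obtain ⟨f, hfe, huf, hzf⟩ := exists_ne_of_mem_cycleSpace hz (u := u)
          (e := ⟨s(u, w), hSH h⟩) (by simp) (hSz _ h)
        obtain ⟨x, hx⟩ := Sym2.mem_iff_exists.1 huf
        have hux : S.Adj u x := by
          have := hzS f hzf
          rwa [hx] at this
        have hxw : x ≠ w := fun h' => hfe (Subtype.ext (by rw [hx, h']))
        have hxs : x ∉ (SimpleGraph.Walk.cons h q).support := fun hmem => by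
          have := hac.eq_snd_of_adj_start hp hux hmem
          simp at this
          exact hxw this
        have := hmax x v (SimpleGraph.Walk.cons hux.symm (SimpleGraph.Walk.cons h q))
          (hp.cons hxs)
        simp at this
  simp only [SimpleGraph.IsAcyclic] at hac
  push Not at hac
  obtain ⟨u, p, hp⟩ := hac
  refine ⟨u, p.mapLe hSH, hp.mapLe hSH, fun e he => hSz e ?_⟩
  rw [SimpleGraph.Walk.edges_mapLe_eq_edges] at he
  exact p.edges_subset_edgeSet he

lemma exists_isCycle_of_isCirc {z : H.edgeSet → ZMod 2} (hz : IsCirc (cycleSpace H) z) :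
    ∃ (u : V) (p : H.Walk u u), p.IsCycle ∧ ∀ e : H.edgeSet, (e : Sym2 V) ∈ p.edges ↔ z e ≠ 0 := by
  classical
  obtain ⟨u, p, hp, hpz⟩ := exists_isCycle_of_mem_cycleSpace hz.1 hz.2.1
  refine ⟨u, p, hp, fun e => ⟨hpz e, fun h => ?_⟩⟩
  have h1 := hz.2.2 (walkChain p) (walkChain_mem_cycleSpace p) ?_
    (fun e he => hpz e (mem_edges_of_walkChain_ne he))
  · exact mem_edges_of_walkChain_ne (h1 ▸ h)
  · cases p with
    | nil => simp at hp
    | cons h q =>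
      intro h0
      have := congrFun h0 ⟨s(_, _), h⟩
      have h2 := hp.isCircuit.isTrail.count_edges_eq_one (e := s(_, _))
        (by rw [SimpleGraph.Walk.edges_cons]; exact List.mem_cons_self)
      simp only [walkChain, h2] at this
      simp at this

lemma exists_isCirc_of_adj (h2 : ∀ u x y, x ≠ y → H.Adj u x → H.Adj u y →
      ∃ p : H.Walk x y, u ∉ p.support) {u : V} {e f : H.edgeSet} (hef : e ≠ f)
    (he : u ∈ (e : Sym2 V)) (hf : u ∈ (f : Sym2 V)) :
    ∃ c, IsCirc (cycleSpace H) c ∧ c e ≠ 0 ∧ c f ≠ 0 := by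
  classical
  obtain ⟨e, heH⟩ := e
  obtain ⟨f, hfH⟩ := f
  obtain ⟨x, rfl⟩ := Sym2.mem_iff_exists.1 he
  obtain ⟨y, rfl⟩ := Sym2.mem_iff_exists.1 hf
  have hxy : x ≠ y := fun h => hef (by subst h; rfl)
  have hux : H.Adj u x := heH
  have huy : H.Adj u y := hfH
  obtain ⟨p, hp⟩ := h2 u x y hxy hux huy
  set w := SimpleGraph.Walk.cons hux (p.concat huy.symm) with hw
  have hnot : ∀ z, s(u, z) ∉ p.edges := fun z h => hp (p.fst_mem_support_of_mem_edges h)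
  have hsupp : ∀ g : H.edgeSet, walkChain w g ≠ 0 → u ∈ (g : Sym2 V) →
      g = ⟨s(u, x), heH⟩ ∨ g = ⟨s(u, y), hfH⟩ := by
    intro g hg hug
    have := mem_edges_of_walkChain_ne hg
    rw [hw, SimpleGraph.Walk.edges_cons, SimpleGraph.Walk.edges_concat] at this
    simp only [List.concat_eq_append, List.mem_cons, List.mem_append, List.not_mem_nil, or_false] at this
    rcases this with h | h | h
    · exact Or.inl (Subtype.ext h)
    · obtain ⟨t, ht⟩ := Sym2.mem_iff_exists.1 hug
      rw [ht] at h
      exact absurd h (hnot t)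
    · exact Or.inr (Subtype.ext (by rw [h, Sym2.eq_swap]))
  have hwe : walkChain w ⟨s(u, x), heH⟩ ≠ 0 := by
    have : ¬ s(y, u) = s(u, x) := by
      intro h; rw [Sym2.eq_swap] at h; exact hxy (Sym2.congr_right.1 h).symm
    simp [walkChain, hw, SimpleGraph.Walk.edges_concat, List.count_append,
      List.count_eq_zero.2 (hnot x), this]
  obtain ⟨c, hc, hce, hcw⟩ := exists_isCirc_of_ne (walkChain_mem_cycleSpace w) hwe
  obtain ⟨g, hge, hug, hcg⟩ := exists_ne_of_mem_cycleSpace hc.1 he hce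
  rcases hsupp g (hcw g hcg) hug with h | h
  · exact absurd h hge
  · exact ⟨c, hc, hce, h ▸ hcg⟩

/-- The edge sets of cycles of a graph. -/
def cycleEdgeSets {V : Type*} (H : SimpleGraph V) : Set (Set (Sym2 V)) :=
  {S | ∃ (u : V) (p : H.Walk u u), p.IsCycle ∧ S = {e | e ∈ p.edges}}

/-- A graph that is 2-connected up to isolated vertices has quadratically many cycles. -/
theorem choose_le_ncard_cycleEdgeSets
    (h2 : ∀ u x y, x ≠ y → H.Adj u x → H.Adj u y → ∃ p : H.Walk x y, u ∉ p.support)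
    (h1 : ∀ a b, (∃ x, H.Adj a x) → (∃ x, H.Adj b x) → H.Reachable a b) :
    (H.edgeSet.ncard - Fintype.card V + 1).choose 2 ≤ (cycleEdgeSets H).ncard := by
  classical
  have hdim := ncard_edgeSet_le_finrank_cycleSpace H
  let R : H.edgeSet → H.edgeSet → Prop := fun e f =>
    e = f ∨ ∃ c, IsCirc (cycleSpace H) c ∧ c e ≠ 0 ∧ c f ≠ 0
  have hRt : ∀ e f g, R e f → R f g → R e g := by
    rintro e f g (rfl | ⟨c, hc, hce, hcf⟩) (rfl | ⟨d, hd, hdf, hdg⟩)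
    · exact Or.inl rfl
    · exact Or.inr ⟨d, hd, hdf, hdg⟩
    · exact Or.inr ⟨c, hc, hce, hcf⟩
    · exact Or.inr (isCirc_trans hc hd hce hcf hdf hdg)
  have hRadj : ∀ u (e f : H.edgeSet), u ∈ (e : Sym2 V) → u ∈ (f : Sym2 V) → R e f := by
    intro u e f he hf
    by_cases h : e = f
    · exact Or.inl h
    · exact Or.inr (exists_isCirc_of_adj h2 h he hf)
  have hRw : ∀ a b (p : H.Walk a b) (e f : H.edgeSet), a ∈ (e : Sym2 V) → b ∈ (f : Sym2 V) →
      R e f := by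
    intro a b p
    induction p with
    | nil => exact hRadj _
    | @cons a c b h p ih =>
      intro e f he hf
      exact hRt _ ⟨s(a, c), h⟩ _ (hRadj a _ _ he (by simp)) (ih _ _ (by simp) hf)
  have hR : ∀ e f, R e f := by
    rintro ⟨e, he⟩ ⟨f, hf⟩
    induction e using Sym2.ind with
    | _ a a' =>
    induction f using Sym2.ind with
    | _ b b' =>
      obtain ⟨p⟩ := h1 a b ⟨a', he⟩ ⟨b', hf⟩
      exact hRw a b p _ _ (by simp) (by simp)
  have hcount := choose_le_ncard_isCirc (Z := cycleSpace H) (by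
    rintro e f ⟨c, hc, hce⟩ -
    rcases hR e f with rfl | h
    · exact ⟨c, hc, hce, hce⟩
    · exact h)
  refine le_trans (Nat.choose_le_choose 2 (by omega)) (hcount.trans ?_)
  refine Set.ncard_le_ncard_of_injOn (fun c => {e | ∃ h : e ∈ H.edgeSet, c ⟨e, h⟩ ≠ 0}) ?_ ?_
    (Set.toFinite _)
  · intro c hc
    obtain ⟨u, p, hp, hpc⟩ := exists_isCycle_of_isCirc hc
    refine ⟨u, p, hp, ?_⟩
    ext e
    constructor
    · rintro ⟨h, hce⟩
      exact (hpc ⟨e, h⟩).2 hce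
    · intro h
      exact ⟨p.edges_subset_edgeSet h, (hpc ⟨e, p.edges_subset_edgeSet h⟩).1 h⟩
  · intro c _ d _ hcd
    funext e
    refine zmod_two_eq_of_ne ?_
    have := Set.ext_iff.1 hcd e
    simpa using this

end CycleSpace

section Menger

variable {V : Type*}

/-- `S` meets every walk of `G` from `A` to `B`. -/
def Separates (G : SimpleGraph V) (A B : Set V) (S : Finset V) : Prop :=
  ∀ a ∈ A, ∀ b ∈ B, ∀ p : G.Walk a b, ∃ s ∈ S, s ∈ p.support

lemma Separates.symm {G : SimpleGraph V} {A B : Set V} {S : Finset V} (h : Separates G A B S) :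
    Separates G B A S := fun b hb a ha p => by
  obtain ⟨s, hs, hsp⟩ := h a ha b hb p.reverse
  exact ⟨s, hs, by simpa using hsp⟩

/-- There are `k` pairwise disjoint paths of `G` from `A` to `B`. -/
def Linked (G : SimpleGraph V) (A B : Set V) (k : ℕ) : Prop :=
  ∃ (s t : Fin k → V) (p : ∀ i, G.Walk (s i) (t i)), (∀ i, s i ∈ A) ∧ (∀ i, t i ∈ B) ∧
    (∀ i, (p i).IsPath) ∧ ∀ i j, i ≠ j → ∀ u, u ∈ (p i).support → u ∉ (p j).support

lemma exists_walk_deleteEdges_or {G : SimpleGraph V} {e : Sym2 V} {S : Set V} {a b : V}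
    (p : G.Walk a b) (hp : ∀ u ∈ p.support, u ∉ S) :
    (∃ q : (G.deleteEdges {e}).Walk a b, ∀ u ∈ q.support, u ∉ S) ∨
    ∃ x y, s(x, y) = e ∧ G.Adj x y ∧
      (∃ q : (G.deleteEdges {e}).Walk a x, ∀ u ∈ q.support, u ∉ S) ∧
      ∃ q : (G.deleteEdges {e}).Walk y b, ∀ u ∈ q.support, u ∉ S := by
  induction p with
  | nil => exact Or.inl ⟨.nil, by simpa using hp⟩
  | @cons a c b h p ih =>
    simp only [SimpleGraph.Walk.support_cons, List.mem_cons, forall_eq_or_imp] at hp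
    by_cases he : s(a, c) = e
    · rcases ih hp.2 with ⟨q, hq⟩ | ⟨x, y, hxy, hadj, ⟨q, hq⟩, ⟨r, hr⟩⟩
      · exact Or.inr ⟨a, c, he, h, ⟨.nil, by simpa using hp.1⟩, q, hq⟩
      · have : a ∈ s(x, y) := by rw [hxy, ← he]; simp
        rcases Sym2.mem_iff.1 this with rfl | rfl
        · exact Or.inr ⟨a, y, hxy, hadj, ⟨.nil, by simpa using hp.1⟩, r, hr⟩
        · exact Or.inl ⟨r, hr⟩
    · have h' : (G.deleteEdges {e}).Adj a c := by simpa [SimpleGraph.deleteEdges_adj] using ⟨h, he⟩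
      rcases ih hp.2 with ⟨q, hq⟩ | ⟨x, y, hxy, hadj, ⟨q, hq⟩, ⟨r, hr⟩⟩
      · exact Or.inl ⟨.cons h' q, by simpa using ⟨hp.1, hq⟩⟩
      · exact Or.inr ⟨x, y, hxy, hadj, ⟨.cons h' q, by simpa using ⟨hp.1, hq⟩⟩, r, hr⟩

lemma exists_prefix_deleteEdges [DecidableEq V] {G : SimpleGraph V} {A B : Set V} {x y : V}
    {S : Finset V} (hS : Separates (G.deleteEdges {s(x, y)}) A B S)
    (hy : ∃ b ∈ B, ∃ q : (G.deleteEdges {s(x, y)}).Walk y b, ∀ u ∈ q.support, u ∉ S) {c b : V}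
    (hb : b ∈ B) (p : G.Walk c b) (hcS : c ∉ S)
    (hc : ∃ a ∈ A, ∃ q : (G.deleteEdges {s(x, y)}).Walk a c, ∀ u ∈ q.support, u ∉ S) :
    ∃ t ∈ insert x S, ∃ q : (G.deleteEdges {s(x, y)}).Walk c t, ∀ u ∈ q.support, u ∈ p.support := by
  induction p with
  | nil =>
    obtain ⟨a, ha, q, hq⟩ := hc
    obtain ⟨s, hs, hsq⟩ := hS a ha _ hb q
    exact absurd hs (hq s hsq)
  | @cons c d b h p ih =>
    by_cases hcx : c = x
    · subst hcx
      exact ⟨c, by simp, .nil, by simp⟩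
    obtain ⟨a, ha, q, hq⟩ := hc
    by_cases he : s(c, d) = s(x, y)
    · have hcy : c = y := by
        have : c ∈ s(x, y) := he ▸ (by simp)
        exact (Sym2.mem_iff.1 this).resolve_left hcx
      subst hcy
      obtain ⟨b', hb', r, hr⟩ := hy
      obtain ⟨s, hs, hsq⟩ := hS a ha _ hb' (q.append r)
      rcases (SimpleGraph.Walk.mem_support_append_iff _ _).1 hsq with h | h
      · exact absurd hs (hq s h)
      · exact absurd hs (hr s h)
    have h' : (G.deleteEdges {s(x, y)}).Adj c d := by
      rw [SimpleGraph.deleteEdges_adj]; exact ⟨h, he⟩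
    by_cases hd : d ∈ S
    · exact ⟨d, by simp [hd], .cons h' .nil, by simp⟩
    · obtain ⟨t, ht, r, hr⟩ := ih hb hd ⟨a, ha, q.concat h', fun u hu => by
        rw [SimpleGraph.Walk.support_concat] at hu
        simp only [List.mem_append, List.mem_singleton] at hu
        rcases hu with hu | rfl
        · exact hq u hu
        · exact hd⟩
      refine ⟨t, ht, .cons h' r, fun u hu => ?_⟩
      rw [SimpleGraph.Walk.support_cons, List.mem_cons] at hu ⊢
      exact hu.imp_right (hr u)

lemma Separates.of_insert [DecidableEq V] {G : SimpleGraph V} {A B : Set V} {x y : V}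
    {S U : Finset V} (hS : Separates (G.deleteEdges {s(x, y)}) A B S)
    (hy : ∃ b ∈ B, ∃ q : (G.deleteEdges {s(x, y)}).Walk y b, ∀ u ∈ q.support, u ∉ S)
    (hU : Separates (G.deleteEdges {s(x, y)}) A ↑(insert x S) U) : Separates G A B U := by
  intro a ha b hb p
  obtain ⟨t, ht, q, hq⟩ : ∃ t ∈ insert x S, ∃ q : (G.deleteEdges {s(x, y)}).Walk a t,
      ∀ u ∈ q.support, u ∈ p.support := by
    by_cases haS : a ∈ S
    · exact ⟨a, by simp [haS], .nil, by simp⟩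
    · exact exists_prefix_deleteEdges hS hy hb p haS ⟨a, ha, .nil, by simpa using haS⟩
  obtain ⟨s, hs, hsq⟩ := hU a ha t (by exact_mod_cast ht) q
  exact ⟨s, hs, hq s hsq⟩

/-- In a linkage from `A` to a set of size `k`, a vertex of that set is an endpoint
of the path containing it. -/
lemma eq_of_mem_of_disjoint {k : ℕ} {t : Fin k → V} {P : Fin k → Set V} (htP : ∀ i, t i ∈ P i)
    (hdisj : ∀ i j, i ≠ j → ∀ u, u ∈ P i → u ∉ P j) {T : Finset V} (hT : T.card = k)
    (htT : ∀ i, t i ∈ T) : Function.Injective t ∧ (∀ u ∈ T, ∃ i, t i = u) ∧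
      ∀ i, ∀ u ∈ T, u ∈ P i → u = t i := by
  classical
  have hinj : Function.Injective t := fun i j hij => by
    by_contra hne
    exact hdisj i j hne (t i) (htP i) (hij ▸ htP j)
  have himg : Finset.univ.image t = T := Finset.eq_of_subset_of_card_le
    (fun u hu => by
      obtain ⟨i, -, rfl⟩ := Finset.mem_image.1 hu
      exact htT i)
    (by rw [Finset.card_image_of_injective _ hinj, Finset.card_univ, Fintype.card_fin, hT])
  have hsurj : ∀ u ∈ T, ∃ i, t i = u := fun u hu => by
    rw [← himg] at hu
    obtain ⟨i, -, h⟩ := Finset.mem_image.1 hu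
    exact ⟨i, h⟩
  refine ⟨hinj, hsurj, fun i u hu hui => ?_⟩
  obtain ⟨j, rfl⟩ := hsurj u hu
  by_contra hne
  exact hdisj i j (fun h => hne (h ▸ rfl)) (t j) hui (htP j)

lemma Linked.combine [DecidableEq V] {G : SimpleGraph V} {A B : Set V} {x y : V} {k : ℕ}
    {S : Finset V} (hxy : G.Adj x y) (hS : Separates (G.deleteEdges {s(x, y)}) A B S)
    (hx : x ∉ S) (hxk : (insert x S).card = k) (hyk : (insert y S).card = k)
    (h1 : Linked (G.deleteEdges {s(x, y)}) A ↑(insert x S) k)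
    (h2 : Linked (G.deleteEdges {s(x, y)}) ↑(insert y S) B k) : Linked G A B k := by
  obtain ⟨a, t, P, ha, ht, hP, hPd⟩ := h1
  obtain ⟨r, b, Q, hr, hb, hQ, hQd⟩ := h2
  have ht' : ∀ i, t i ∈ insert x S := fun i => by exact_mod_cast ht i
  have hr' : ∀ i, r i ∈ insert y S := fun i => by exact_mod_cast hr i
  obtain ⟨htinj, -, htP⟩ := eq_of_mem_of_disjoint (P := fun i => {u | u ∈ (P i).support})
    (fun i => (P i).end_mem_support) hPd hxk ht'
  obtain ⟨hrinj, hrsurj, hrQ⟩ := eq_of_mem_of_disjoint (P := fun i => {u | u ∈ (Q i).support})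
    (fun i => (Q i).start_mem_support) hQd hyk hr'
  have hj : ∀ i, ∃ j, (t i = x ∧ r j = y) ∨ (t i ∈ S ∧ r j = t i) := fun i => by
    rcases Finset.mem_insert.1 (ht' i) with h | h
    · obtain ⟨j, hj⟩ := hrsurj y (by simp)
      exact ⟨j, Or.inl ⟨h, hj⟩⟩
    · obtain ⟨j, hj⟩ := hrsurj (t i) (by simp [h])
      exact ⟨j, Or.inr ⟨h, hj⟩⟩
  choose j hj using hj
  have hy : y ∉ S := fun h => by
    have h3 := Finset.card_insert_of_notMem hx
    rw [Finset.insert_eq_of_mem h] at hyk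
    omega
  have hjinj : Function.Injective j := fun i i' h => by
    apply htinj
    have h3 := hj i
    have h4 := hj i'
    rw [← h] at h4
    rcases h3 with ⟨h3, h5⟩ | ⟨h3, h5⟩ <;> rcases h4 with ⟨h4, h6⟩ | ⟨h4, h6⟩
    · rw [h3, h4]
    · rw [h6] at h5; rw [h5] at h4; exact absurd h4 hy
    · rw [h6] at h5; rw [← h5] at h3; exact absurd h3 hy
    · rw [← h5, h6]
  have hw : ∀ i, ∃ q : G.Walk (a i) (b (j i)), q.IsPath ∧ ∀ u ∈ q.support,
      u ∈ (P i).support ∨ u ∈ (Q (j i)).support := fun i => by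
    have hle := G.deleteEdges_le {s(x, y)}
    suffices ∃ q : G.Walk (a i) (b (j i)), ∀ u ∈ q.support,
        u ∈ (P i).support ∨ u ∈ (Q (j i)).support by
      obtain ⟨q, hq⟩ := this
      exact ⟨q.bypass, q.bypass_isPath, fun u hu => hq u (q.support_bypass_subset_support hu)⟩
    rcases hj i with ⟨h3, h4⟩ | ⟨h3, h4⟩
    · have hadj : G.Adj (t i) (r (j i)) := by rw [h3, h4]; exact hxy
      refine ⟨((P i).mapLe hle).append (.cons hadj ((Q (j i)).mapLe hle)), fun u hu => ?_⟩
      rcases (SimpleGraph.Walk.mem_support_append_iff _ _).1 hu with h | h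
      · rw [SimpleGraph.Walk.support_mapLe_eq_support] at h
        exact Or.inl h
      · rw [SimpleGraph.Walk.support_cons, List.mem_cons,
          SimpleGraph.Walk.support_mapLe_eq_support] at h
        rcases h with rfl | h
        · exact Or.inl (P i).end_mem_support
        · exact Or.inr h
    · refine ⟨((P i).mapLe hle).append (((Q (j i)).copy h4 rfl).mapLe hle), fun u hu => ?_⟩
      rcases (SimpleGraph.Walk.mem_support_append_iff _ _).1 hu with h | h
      · rw [SimpleGraph.Walk.support_mapLe_eq_support] at h
        exact Or.inl h
      · rw [SimpleGraph.Walk.support_mapLe_eq_support, SimpleGraph.Walk.support_copy] at h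
        exact Or.inr h
  have hPQ : ∀ i i', i ≠ i' → ∀ u, u ∈ (P i).support → u ∉ (Q (j i')).support := by
    intro i i' hne u hu hu'
    by_cases huS : u ∈ S
    · have h3 := htP i u (by simp [huS]) hu
      have h4 := hrQ (j i') u (by simp [huS]) hu'
      apply hne
      apply htinj
      rcases hj i' with ⟨h5, h6⟩ | ⟨h5, h6⟩
      · rw [← h4] at h6; rw [h6] at huS; exact absurd huS hy
      · rw [← h6, ← h4, h3]
    · obtain ⟨s, hs, hsq⟩ := hS _ (ha i) _ (hb (j i'))
        (((P i).takeUntil u hu).append ((Q (j i')).reverse.takeUntil u (by simpa using hu')).reverse)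
      rcases (SimpleGraph.Walk.mem_support_append_iff _ _).1 hsq with h | h
      · have h3 := htP i s (by simp [hs]) ((P i).support_takeUntil_subset_support hu h)
        have hne : t i ≠ u := fun h' => huS (h' ▸ h3 ▸ hs)
        exact SimpleGraph.Walk.endpoint_notMem_support_takeUntil (hP i) hu hne (h3 ▸ h)
      · rw [SimpleGraph.Walk.support_reverse, List.mem_reverse] at h
        have h3 := hrQ (j i') s (by simp [hs])
          (by simpa using (Q (j i')).reverse.support_takeUntil_subset_support _ h)
        have hne : r (j i') ≠ u := fun h' => huS (h' ▸ h3 ▸ hs)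
        exact SimpleGraph.Walk.endpoint_notMem_support_takeUntil (hQ (j i')).reverse _ hne (h3 ▸ h)
  choose q hq hqs using hw
  refine ⟨a, fun i => b (j i), q, ha, fun i => hb _, hq, fun i i' hne u hu hu' => ?_⟩
  rcases hqs i u hu with h | h <;> rcases hqs i' u hu' with h' | h'
  · exact hPd i i' hne u h h'
  · exact hPQ i i' hne u h h'
  · exact hPQ i' i hne.symm u h' h
  · exact hQd _ _ (fun h => hne (hjinj h)) u h h'

lemma Linked.symm {G : SimpleGraph V} {A B : Set V} {k : ℕ} (h : Linked G A B k) :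
    Linked G B A k := by
  obtain ⟨s, t, p, hs, ht, hp, hd⟩ := h
  exact ⟨t, s, fun i => (p i).reverse, ht, hs, fun i => (hp i).reverse,
    fun i j hij u hu => by simpa using hd i j hij u (by simpa using hu)⟩

/-- **Menger's theorem**, set version. -/
theorem linked_of_forall_separates [Finite V] (G : SimpleGraph V) (A B : Set V) (k : ℕ)
    (h : ∀ S, Separates G A B S → k ≤ S.card) : Linked G A B k := by
  classical
  have := Fintype.ofFinite V
  induction G using WellFoundedLT.induction generalizing A B with
  | ind G ih =>
    by_cases hbot : G = ⊥
    · subst hbot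
      have h1 := h (A ∩ B).toFinset fun a ha b hb p => by
        cases p with
        | nil => exact ⟨a, by simp [ha, hb], by simp⟩
        | cons h p => exact absurd h (by simp)
      obtain ⟨T, hTs, hT⟩ := Finset.exists_subset_card_eq h1
      let f : Fin k → V := fun i => (T.equivFinOfCardEq hT).symm i
      have hf : ∀ i, f i ∈ A ∩ B := fun i => by
        have := hTs ((T.equivFinOfCardEq hT).symm i).2
        simpa using this
      refine ⟨f, f, fun i => .nil, fun i => (hf i).1, fun i => (hf i).2, fun i => by simp,
        fun i j hij u hu hu' => hij ?_⟩
      simp only [SimpleGraph.Walk.support_nil, List.mem_singleton] at hu hu'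
      exact (T.equivFinOfCardEq hT).symm.injective (Subtype.ext (hu.symm.trans hu'))
    obtain ⟨x₀, y₀, hxy₀⟩ := SimpleGraph.ne_bot_iff_exists_adj.1 hbot
    obtain ⟨e, he₀⟩ : ∃ e, e = s(x₀, y₀) := ⟨_, rfl⟩
    have hlt : G.deleteEdges {e} < G := by
      refine lt_of_le_of_ne (G.deleteEdges_le _) fun heq => ?_
      rw [← heq] at hxy₀
      simp [SimpleGraph.deleteEdges_adj, he₀] at hxy₀
    by_cases hsep : ∀ S, Separates (G.deleteEdges {e}) A B S → k ≤ S.card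
    · obtain ⟨s, t, p, hs, ht, hp, hd⟩ := ih _ hlt A B hsep
      refine ⟨s, t, fun i => (p i).mapLe hlt.le, hs, ht, fun i => (hp i).mapLe hlt.le, ?_⟩
      simpa only [SimpleGraph.Walk.support_mapLe_eq_support] using hd
    push Not at hsep
    obtain ⟨S, hS, hSk⟩ := hsep
    have hnS : ¬ Separates G A B S := fun h' => absurd (h S h') (by omega)
    simp only [Separates] at hnS
    push Not at hnS
    obtain ⟨a, ha, b, hb, p, hp⟩ := hnS
    rcases exists_walk_deleteEdges_or (e := e) (S := (S : Set V)) p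
      (fun u hu hu' => hp u hu' hu) with ⟨q, hq⟩ | ⟨x, y, he, hxy, ⟨q, hq⟩, ⟨r, hr⟩⟩
    · obtain ⟨s, hs, hsq⟩ := hS a ha b hb q
      exact absurd hs (hq s hsq)
    subst he
    have hx : x ∉ S := hq x q.end_mem_support
    have hy : y ∉ S := hr y r.start_mem_support
    have h1 : ∀ U, Separates (G.deleteEdges {s(x, y)}) A ↑(insert x S) U → k ≤ U.card :=
      fun U hU => h U (hS.of_insert ⟨b, hb, r, hr⟩ hU)
    have h2 : ∀ U, Separates (G.deleteEdges {s(x, y)}) ↑(insert y S) B U → k ≤ U.card := by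
      intro U hU
      rw [Sym2.eq_swap] at hS hU
      have := hS.symm.of_insert (U := U) ⟨a, ha, by
        rw [Sym2.eq_swap]
        exact ⟨q.reverse, by simpa using hq⟩⟩ hU.symm
      exact h U this.symm
    have hk : ∀ z ∉ S, (insert z S).card ≤ k := fun z hz => by
      rw [Finset.card_insert_of_notMem hz]; omega
    have l1 := ih _ hlt _ _ h1
    have l2 := ih _ hlt _ _ h2
    have hxk : (insert x S).card = k := le_antisymm (hk x hx) (h1 _ fun a ha b hb p =>
      ⟨b, by exact_mod_cast hb, p.end_mem_support⟩)
    have hyk : (insert y S).card = k := le_antisymm (hk y hy) (h2 _ fun a ha b hb p =>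
      ⟨a, by exact_mod_cast ha, p.start_mem_support⟩)
    exact Linked.combine hxy hS hx hxk hyk l1 l2

end Menger

section K4Subdivision

variable {G : SimpleGraph V}

lemma SimpleGraph.Walk.IsPath.ncard_neighborSet_toSubgraph_le_two {a b w : V} {p : G.Walk a b}
    (hp : p.IsPath) : (p.toSubgraph.neighborSet w).ncard ≤ 2 := by
  by_cases hnp : p.Nil
  · cases hnp
    simp [SimpleGraph.Subgraph.neighborSet]
  by_cases hw : w ∈ p.support
  · obtain ⟨i, rfl, hi⟩ := SimpleGraph.Walk.mem_support_iff_exists_getVert.1 hw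
    rcases Nat.eq_zero_or_pos i with rfl | hi0
    · simp [hp.neighborSet_toSubgraph_startpoint hnp]
    rcases hi.lt_or_eq with hi | rfl
    · exact (hp.ncard_neighborSet_toSubgraph_internal_eq_two hi0.ne' hi).le
    · simp [hp.neighborSet_toSubgraph_endpoint hnp]
  · have : p.toSubgraph.neighborSet w = ∅ := by
      ext u
      simp only [SimpleGraph.Subgraph.mem_neighborSet, Set.mem_empty_iff_false, iff_false]
      exact fun h => hw (by simpa using h.fst_mem)
    simp [this]

lemma iSup_paths_adj {b : Fin 4 → V}
    (P : ∀ p : Fin 4 × Fin 4, p.1 < p.2 → G.Walk (b p.1) (b p.2)) {u w : V} :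
    (⨆ (p : Fin 4 × Fin 4) (h : p.1 < p.2), (P p h).toSubgraph).Adj u w ↔
      ∃ p h, (P p h).toSubgraph.Adj u w := by
  simp only [SimpleGraph.Subgraph.iSup_adj]

lemma IsK4SubdivisionOn.ncard_neighborSet_le_two {K : G.Subgraph} {b : Fin 4 → V}
    (hK : IsK4SubdivisionOn K b) {w : V} (hw : ∀ i, b i ≠ w) : (K.neighborSet w).ncard ≤ 2 := by
  obtain ⟨hb, P, hP, hP0, rfl, hPP⟩ := hK
  by_cases h : ∃ p h, w ∈ (P p h).support
  · obtain ⟨p, hp, hwp⟩ := h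
    convert (hP p hp).ncard_neighborSet_toSubgraph_le_two (w := w) using 2
    ext u
    simp only [SimpleGraph.Subgraph.mem_neighborSet, iSup_paths_adj]
    refine ⟨fun ⟨q, hq, h⟩ => ?_, fun h => ⟨p, hp, h⟩⟩
    by_cases hpq : p = q
    · subst hpq
      exact h
    have := (hPP p q hp hq hpq w hwp (by simpa using h.fst_mem)).1
    rcases this with h | h
    · exact absurd h.symm (hw _)
    · exact absurd h.symm (hw _)
  · push Not at h
    have : (⨆ (p : Fin 4 × Fin 4) (h : p.1 < p.2), (P p h).toSubgraph).neighborSet w = ∅ := by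
      ext u
      simp only [SimpleGraph.Subgraph.mem_neighborSet, Set.mem_empty_iff_false, iff_false,
        iSup_paths_adj]
      exact fun ⟨p, hp, h'⟩ => h p hp (by simpa using h'.fst_mem)
    simp [this]

lemma IsK4SubdivisionOn.ncard_neighborSet_branch_le_three {K : G.Subgraph} {b : Fin 4 → V}
    (hK : IsK4SubdivisionOn K b) (i : Fin 4) : (K.neighborSet (b i)).ncard ≤ 3 := by
  classical
  obtain ⟨hb, P, hP, hP0, rfl, hPP⟩ := hK
  let F : Finset (Fin 4 × Fin 4) := Finset.univ.filter fun p => p.1 < p.2 ∧ (p.1 = i ∨ p.2 = i)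
  have hF : F.card = 3 := by
    revert i
    decide
  have hg : ∀ p, ∃ g, ∀ h u, p ∈ F → (P p h).toSubgraph.Adj (b i) u → u = g := by
    intro p
    by_cases hp : p ∈ F
    · obtain ⟨-, hlt, hpi⟩ := Finset.mem_filter.1 hp
      have hnil := SimpleGraph.Walk.not_nil_iff_lt_length.2 (hP0 p hlt)
      rcases hpi with rfl | rfl
      · refine ⟨(P p hlt).snd, fun _ u _ hu => ?_⟩
        rwa [← SimpleGraph.Subgraph.mem_neighborSet,
          (hP p hlt).neighborSet_toSubgraph_startpoint hnil] at hu
      · refine ⟨(P p hlt).penultimate, fun _ u _ hu => ?_⟩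
        rwa [← SimpleGraph.Subgraph.mem_neighborSet,
          (hP p hlt).neighborSet_toSubgraph_endpoint hnil] at hu
    · exact ⟨b i, fun _ _ h => absurd h hp⟩
  choose g hg using hg
  have hmem : ∀ p hp, b i ∈ (P p hp).support → p ∈ F := by
    intro p hp h
    refine Finset.mem_filter.2 ⟨Finset.mem_univ _, hp, ?_⟩
    by_contra! hne
    obtain ⟨q, hq, hqi⟩ : ∃ q : Fin 4 × Fin 4, q.1 < q.2 ∧ (q.1 = i ∨ q.2 = i) :=
      (by decide : ∀ i : Fin 4, ∃ q : Fin 4 × Fin 4, q.1 < q.2 ∧ (q.1 = i ∨ q.2 = i)) i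
    have hpq : p ≠ q := by
      rintro rfl
      tauto
    have hbq : b i ∈ (P q hq).support := by
      rcases hqi with rfl | rfl
      · exact (P q hq).start_mem_support
      · exact (P q hq).end_mem_support
    rcases (hPP p q hp hq hpq _ h hbq).1 with h | h
    · exact hne.1 (hb h).symm
    · exact hne.2 (hb h).symm
  have hsub : (⨆ (p : Fin 4 × Fin 4) (h : p.1 < p.2), (P p h).toSubgraph).neighborSet (b i) ⊆
      (F.image g : Set V) := by
    intro u hu
    rw [SimpleGraph.Subgraph.mem_neighborSet, iSup_paths_adj] at hu
    obtain ⟨p, hp, h⟩ := hu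
    have hpF := hmem p hp (by simpa using h.fst_mem)
    rw [Finset.mem_coe, hg p hp u hpF h]
    exact Finset.mem_image_of_mem _ hpF
  calc _ ≤ (F.image g : Set V).ncard := Set.ncard_le_ncard hsub (Finset.finite_toSet _)
    _ = (F.image g).card := Set.ncard_coe_finset _
    _ ≤ F.card := Finset.card_image_le
    _ = 3 := hF

lemma IsK4SubdivisionOn.exists_eq_of_three_le {K : G.Subgraph} {b : Fin 4 → V}
    (hK : IsK4SubdivisionOn K b) {w : V} (hw : 3 ≤ (K.neighborSet w).ncard) : ∃ i, b i = w := by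
  by_contra! h
  have := hK.ncard_neighborSet_le_two h
  omega

/-- In a subgraph whose vertices have degree at most two at the inner vertices of a path starting
outside a cycle, the cycle can meet the path only in its last vertex. -/
lemma SimpleGraph.Walk.notMem_support_cycle_of_ncard_neighborSet_le_two {K : G.Subgraph}
    {a b d : V} {P : G.Walk a b} (hP : P.IsPath) (hPK : ∀ e ∈ P.edges, e ∈ K.edgeSet)
    (hdeg : ∀ w ∈ P.support, w ≠ a → w ≠ b → (K.neighborSet w).ncard ≤ 2)
    (hfin : ∀ w, (K.neighborSet w).Finite)
    {D : G.Walk d d} (hD : D.IsCycle) (hDK : ∀ e ∈ D.edges, e ∈ K.edgeSet) (ha : a ∉ D.support) :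
    ∀ u ∈ P.support, u ≠ b → u ∉ D.support := by
  induction P with
  | nil => simp
  | @cons a c b h P ih =>
    intro u hu hub
    rw [SimpleGraph.Walk.cons_isPath_iff] at hP
    rw [SimpleGraph.Walk.support_cons, List.mem_cons] at hu
    rcases hu with rfl | hu
    · exact ha
    by_cases hcb : c = b
    · subst hcb
      cases SimpleGraph.Walk.isPath_iff_nil.1 hP.1
      simp only [SimpleGraph.Walk.support_nil, List.mem_singleton] at hu
      exact absurd hu hub
    refine ih hP.1 (fun e he => hPK e (by simp [he])) (fun w hw hwc hwb => ?_) ?_ u hu hub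
    · exact hdeg w (by simp [hw]) (fun h => hP.2 (h ▸ hw)) hwb
    · intro hc
      have hca : K.Adj c a := SimpleGraph.Subgraph.adj_symm _ (hPK s(a, c) (by simp))
      have hsub : D.toSubgraph.neighborSet c ⊆ K.neighborSet c := fun w hw =>
        hDK s(c, w) (by
          rwa [SimpleGraph.Subgraph.mem_neighborSet,
            SimpleGraph.Walk.adj_toSubgraph_iff_mem_edges] at hw)
      have heq := Set.eq_of_subset_of_ncard_le hsub (by
        rw [hD.ncard_neighborSet_toSubgraph_eq_two hc]
        exact hdeg c (by simp) h.ne' hcb) (hfin c)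
      have : a ∈ D.toSubgraph.neighborSet c := heq ▸ hca
      exact ha (by simpa using this.snd_mem)

end K4Subdivision

section Arcs

variable {G : SimpleGraph V}

lemma SimpleGraph.Walk.mem_support_iff_eq_or_mem_tail {a b u : V} (p : G.Walk a b) :
    u ∈ p.support ↔ u = a ∨ u ∈ p.support.tail := by
  conv_lhs => rw [← p.cons_tail_support]
  exact List.mem_cons

lemma SimpleGraph.Walk.end_mem_support_tail {a b : V} (p : G.Walk a b) (h : a ≠ b) :
    b ∈ p.support.tail :=
  (p.mem_support_iff_eq_or_mem_tail.1 p.end_mem_support).resolve_left h.symm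

/-- Three walks between distinct vertices that together form a cycle are paths meeting only in
their common endpoints. -/
lemma SimpleGraph.Walk.IsCycle.isPath_of_append {a b c : V} {p : G.Walk a b} {q : G.Walk b c}
    {r : G.Walk c a} (h : (p.append (q.append r)).IsCycle) (hab : a ≠ b) (hbc : b ≠ c)
    (hca : c ≠ a) : p.IsPath ∧ q.IsPath ∧ r.IsPath ∧
      (∀ u ∈ p.support, u ∈ q.support → u = b) ∧ (∀ u ∈ q.support, u ∈ r.support → u = c) ∧
      ∀ u ∈ r.support, u ∈ p.support → u = a := by
  have hn := h.support_nodup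
  rw [SimpleGraph.Walk.tail_support_append, SimpleGraph.Walk.tail_support_append,
    List.nodup_append', List.nodup_append'] at hn
  obtain ⟨hp, ⟨hq, hr, hqr⟩, hpqr⟩ := hn
  have hb := p.end_mem_support_tail hab
  have hc := q.end_mem_support_tail hbc
  have ha := r.end_mem_support_tail hca
  have hqr' : ∀ u, u ∈ q.support.tail → u ∉ r.support.tail := fun u h h' => hqr h h'
  have hpq : ∀ u, u ∈ p.support.tail → u ∉ q.support.tail := fun u h h' =>
    hpqr h (List.mem_append_left _ h')
  have hpr : ∀ u, u ∈ p.support.tail → u ∉ r.support.tail := fun u h h' =>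
    hpqr h (List.mem_append_right _ h')
  refine ⟨?_, ?_, ?_, ?_, ?_, ?_⟩
  · rw [SimpleGraph.Walk.isPath_def, ← SimpleGraph.Walk.cons_tail_support, List.nodup_cons]
    exact ⟨fun h => hpr _ h ha, hp⟩
  · rw [SimpleGraph.Walk.isPath_def, ← SimpleGraph.Walk.cons_tail_support, List.nodup_cons]
    exact ⟨fun h => hpq _ hb h, hq⟩
  · rw [SimpleGraph.Walk.isPath_def, ← SimpleGraph.Walk.cons_tail_support, List.nodup_cons]
    exact ⟨fun h => hqr' _ hc h, hr⟩
  all_goals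
    intro u hu hu'
    rw [SimpleGraph.Walk.mem_support_iff_eq_or_mem_tail] at hu hu'
    grind

/-- Three distinct vertices of a cycle cut it into three arcs. -/
lemma SimpleGraph.Walk.IsCycle.exists_arcs {d a b c : V} {D : G.Walk d d} (hD : D.IsCycle)
    (ha : a ∈ D.support) (hb : b ∈ D.support) (hc : c ∈ D.support) (hab : a ≠ b) (hbc : b ≠ c)
    (hca : c ≠ a) : ∃ (p : G.Walk a b) (q : G.Walk b c) (r : G.Walk a c),
      p.IsPath ∧ q.IsPath ∧ r.IsPath ∧
      (∀ u ∈ p.support, u ∈ q.support → u = b) ∧ (∀ u ∈ q.support, u ∈ r.support → u = c) ∧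
      (∀ u ∈ r.support, u ∈ p.support → u = a) ∧
      (∀ e, e ∈ D.edges ↔ e ∈ p.edges ∨ e ∈ q.edges ∨ e ∈ r.edges) ∧
      ∀ u, u ∈ p.support ∨ u ∈ q.support ∨ u ∈ r.support → u ∈ D.support := by
  classical
  have hR : (D.rotate a ha).IsCycle := (SimpleGraph.Walk.isCycle_rotate ha).2 hD
  have hRe : ∀ e, e ∈ (D.rotate a ha).edges ↔ e ∈ D.edges := fun e =>
    (D.rotate_edges a ha).perm.mem_iff
  have hRs : ∀ u, u ∈ (D.rotate a ha).support ↔ u ∈ D.support := fun u => by simp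
  simp only [← hRe, ← hRs] at hb hc ⊢
  generalize D.rotate a ha = R at *
  rw [← R.take_spec hb] at hR hc ⊢
  rcases (SimpleGraph.Walk.mem_support_append_iff _ _).1 hc with hc' | hc'
  · generalize R.takeUntil b hb = s at *
    generalize R.dropUntil b hb = r at *
    rw [← s.take_spec hc', ← SimpleGraph.Walk.append_assoc] at hR ⊢
    generalize s.takeUntil c hc' = p at *
    generalize s.dropUntil c hc' = q at *
    obtain ⟨hp, hq, hr, hpq, hqr, hrp⟩ := hR.isPath_of_append hca.symm hbc.symm hab.symm
    refine ⟨r.reverse, q.reverse, p, hr.reverse, hq.reverse, hp, ?_, ?_, ?_, ?_, ?_⟩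
    · simp only [SimpleGraph.Walk.support_reverse, List.mem_reverse]
      exact fun u h h' => hqr u h' h
    · simp only [SimpleGraph.Walk.support_reverse, List.mem_reverse]
      exact fun u h h' => hpq u h' h
    · simp only [SimpleGraph.Walk.support_reverse, List.mem_reverse]
      exact fun u h h' => hrp u h' h
    · simp only [SimpleGraph.Walk.edges_append, SimpleGraph.Walk.edges_reverse, List.mem_reverse,
        List.mem_append]
      tauto
    · simp only [SimpleGraph.Walk.mem_support_append_iff, SimpleGraph.Walk.support_reverse,
        List.mem_reverse]
      tauto
  · generalize R.takeUntil b hb = p at *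
    generalize R.dropUntil b hb = s at *
    rw [← s.take_spec hc'] at hR ⊢
    generalize s.takeUntil c hc' = q at *
    generalize s.dropUntil c hc' = r at *
    obtain ⟨hp, hq, hr, hpq, hqr, hrp⟩ := hR.isPath_of_append hab hbc hca
    refine ⟨p, q, r.reverse, hp, hq, hr.reverse, hpq, ?_, ?_, ?_, ?_⟩
    · simpa only [SimpleGraph.Walk.support_reverse, List.mem_reverse] using hqr
    · simpa only [SimpleGraph.Walk.support_reverse, List.mem_reverse] using hrp
    · simp only [SimpleGraph.Walk.edges_append, SimpleGraph.Walk.edges_reverse, List.mem_reverse,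
        List.mem_append]
      tauto
    · simp only [SimpleGraph.Walk.mem_support_append_iff, SimpleGraph.Walk.support_reverse,
        List.mem_reverse]
      tauto

end Arcs

section Construction

variable {G : SimpleGraph V}

/-- Three paths from a vertex to a cycle, disjoint apart from that vertex, form a `K₄`-subdivision
together with the cycle. -/
lemma isK4SubdivisionOn_of_paths {v c₀ c₁ c₂ : V} (T₀ : G.Walk v c₀) (T₁ : G.Walk v c₁)
    (T₂ : G.Walk v c₂) (p : G.Walk c₀ c₁) (q : G.Walk c₁ c₂) (r : G.Walk c₀ c₂)
    (hT₀ : T₀.IsPath) (hT₁ : T₁.IsPath) (hT₂ : T₂.IsPath) (hp : p.IsPath) (hq : q.IsPath)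
    (hr : r.IsPath) (h₀₁ : c₀ ≠ c₁) (h₁₂ : c₁ ≠ c₂) (h₀₂ : c₀ ≠ c₂)
    (hpq : ∀ u ∈ p.support, u ∈ q.support → u = c₁)
    (hqr : ∀ u ∈ q.support, u ∈ r.support → u = c₂)
    (hrp : ∀ u ∈ r.support, u ∈ p.support → u = c₀)
    (hT₀₁ : ∀ u ∈ T₀.support, u ∈ T₁.support → u = v)
    (hT₀₂ : ∀ u ∈ T₀.support, u ∈ T₂.support → u = v)
    (hT₁₂ : ∀ u ∈ T₁.support, u ∈ T₂.support → u = v)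
    {B : Set V} (hv : v ∉ B)
    (hB : ∀ u, u ∈ p.support ∨ u ∈ q.support ∨ u ∈ r.support → u ∈ B)
    (hB₀ : ∀ u ∈ T₀.support, u ∈ B → u = c₀) (hB₁ : ∀ u ∈ T₁.support, u ∈ B → u = c₁)
    (hB₂ : ∀ u ∈ T₂.support, u ∈ B → u = c₂) :
    ∃ K : G.Subgraph, IsK4SubdivisionOn K ![v, c₀, c₁, c₂] ∧ ∀ e, e ∈ K.edgeSet ↔
      e ∈ T₀.edges ∨ e ∈ T₁.edges ∨ e ∈ T₂.edges ∨ e ∈ p.edges ∨ e ∈ q.edges ∨ e ∈ r.edges := by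
  have hc₀ : c₀ ∈ B := hB _ (Or.inl p.start_mem_support)
  have hc₁ : c₁ ∈ B := hB _ (Or.inl p.end_mem_support)
  have hc₂ : c₂ ∈ B := hB _ (Or.inr (Or.inl q.end_mem_support))
  have hv₀ : v ≠ c₀ := fun h => hv (h ▸ hc₀)
  have hv₁ : v ≠ c₁ := fun h => hv (h ▸ hc₁)
  have hv₂ : v ≠ c₂ := fun h => hv (h ▸ hc₂)
  let b : Fin 4 → V := ![v, c₀, c₁, c₂]
  have hcases : ∀ x : Fin 4 × Fin 4, x.1 < x.2 →
      x = (0, 1) ∨ x = (0, 2) ∨ x = (0, 3) ∨ x = (1, 2) ∨ x = (2, 3) ∨ x = (1, 3) := by decide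
  let P : ∀ x : Fin 4 × Fin 4, x.1 < x.2 → G.Walk (b x.1) (b x.2) := fun x h =>
    match x, h with
    | (0, 1), _ => T₀
    | (0, 2), _ => T₁
    | (0, 3), _ => T₂
    | (1, 2), _ => p
    | (2, 3), _ => q
    | (1, 3), _ => r
    | (3, j), h => absurd (show 3 < j from h) (not_lt.2 j.le_last)
  refine ⟨_, ⟨?_, P, ?_, ?_, rfl, ?_⟩, ?_⟩
  · rw [Function.Injective]
    simp only [Fin.forall_fin_succ]
    simp [hv₀, hv₁, hv₂, h₀₁, h₁₂, h₀₂, hv₀.symm, hv₁.symm, hv₂.symm, h₀₁.symm, h₁₂.symm, h₀₂.symm]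
  · intro x hx
    rcases hcases x hx with rfl | rfl | rfl | rfl | rfl | rfl <;> assumption
  · have hpos : ∀ {a b : V} (w : G.Walk a b), a ≠ b → 0 < w.length := fun w h =>
      SimpleGraph.Walk.not_nil_iff_lt_length.1 (SimpleGraph.Walk.not_nil_of_ne h)
    intro x hx
    rcases hcases x hx with rfl | rfl | rfl | rfl | rfl | rfl
    exacts [hpos T₀ hv₀, hpos T₁ hv₁, hpos T₂ hv₂, hpos p h₀₁, hpos q h₁₂, hpos r h₀₂]
  · have hpB : ∀ u ∈ p.support, u ∈ B := fun u h => hB u (Or.inl h)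
    have hqB : ∀ u ∈ q.support, u ∈ B := fun u h => hB u (Or.inr (Or.inl h))
    have hrB : ∀ u ∈ r.support, u ∈ B := fun u h => hB u (Or.inr (Or.inr h))
    have hp₂ : c₂ ∉ p.support := fun h => h₁₂ (hpq _ h q.end_mem_support).symm
    have hq₀ : c₀ ∉ q.support := fun h => h₀₁ (hpq _ p.start_mem_support h)
    have hr₁ : c₁ ∉ r.support := fun h => h₀₁ (hrp _ h p.end_mem_support).symm
    intro x y hx hy hxy u hu hu'
    rcases hcases x hx with rfl | rfl | rfl | rfl | rfl | rfl <;>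
    rcases hcases y hy with rfl | rfl | rfl | rfl | rfl | rfl <;>
    first
    | exact absurd rfl hxy
    | simp [P] at hu hu' ⊢
      grind
  · rintro ⟨y, z⟩
    rw [SimpleGraph.Subgraph.mem_edgeSet, iSup_paths_adj]
    simp only [SimpleGraph.Walk.adj_toSubgraph_iff_mem_edges]
    constructor
    · rintro ⟨x, hx, h⟩
      rcases hcases x hx with rfl | rfl | rfl | rfl | rfl | rfl <;> simp only [P] at h <;> tauto
    · rintro (h | h | h | h | h | h)
      exacts [⟨(0, 1), by decide, h⟩, ⟨(0, 2), by decide, h⟩, ⟨(0, 3), by decide, h⟩,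
        ⟨(1, 2), by decide, h⟩, ⟨(2, 3), by decide, h⟩, ⟨(1, 3), by decide, h⟩]

end Construction

section Fan

variable {G : SimpleGraph V}

lemma exists_isK4Subdivision_of_fan [Finite V] {v d : V} {D : G.Walk d d} (hD : D.IsCycle)
    (hv : v ∉ D.support) (s c : Fin 3 → V) (T : ∀ i, G.Walk (s i) (c i)) (hT : ∀ i, (T i).IsPath)
    (hs : ∀ i, G.Adj v (s i)) (hvT : ∀ i, v ∉ (T i).support) (hc : ∀ i, c i ∈ D.support)
    (hTc : ∀ i, ∀ u ∈ (T i).support, u ∈ D.support → u = c i)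
    (hTT : ∀ i j, i ≠ j → ∀ u, u ∈ (T i).support → u ∉ (T j).support) :
    ∃ K : G.Subgraph, IsK4Subdivision K ∧ (∀ i, K.Adj v (s i)) ∧ 3 ≤ (K.neighborSet v).ncard ∧
      (∀ e ∈ D.edges, e ∈ K.edgeSet) ∧ ∀ (d' : V) (D' : G.Walk d' d'), D'.IsCycle →
        v ∉ D'.support → (∀ e ∈ D'.edges, e ∈ K.edgeSet) → ∀ e ∈ D'.edges, e ∈ D.edges := by
  have hcne : ∀ i j, i ≠ j → c i ≠ c j := fun i j hij h =>
    hTT i j hij (c i) (T i).end_mem_support (by rw [h]; exact (T j).end_mem_support)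
  obtain ⟨p, q, r, hp, hq, hr, hpq, hqr, hrp, he, hsupp⟩ := hD.exists_arcs (hc 0) (hc 1) (hc 2)
    (hcne 0 1 (by decide)) (hcne 1 2 (by decide)) (hcne 2 0 (by decide))
  let P : ∀ i, G.Walk v (c i) := fun i => .cons (hs i) (T i)
  have hP : ∀ i, (P i).IsPath := fun i => (SimpleGraph.Walk.cons_isPath_iff _ _).2 ⟨hT i, hvT i⟩
  have hPs : ∀ i u, u ∈ (P i).support → u = v ∨ u ∈ (T i).support := fun i u hu => by
    simpa [P] using hu
  have hPc : ∀ i, ∀ u ∈ (P i).support, u ∈ {u | u ∈ D.support} → u = c i := fun i u hu huD => by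
    rcases hPs i u hu with rfl | h
    · exact absurd huD hv
    · exact hTc i u h huD
  have hPP : ∀ i j, i ≠ j → ∀ u ∈ (P i).support, u ∈ (P j).support → u = v := by
    intro i j hij u hu hu'
    rcases hPs i u hu with h | h
    · exact h
    rcases hPs j u hu' with h' | h'
    · exact h'
    exact absurd h' (hTT i j hij u h)
  obtain ⟨K, hK, hKe⟩ := isK4SubdivisionOn_of_paths (P 0) (P 1) (P 2) p q r (hP 0) (hP 1) (hP 2)
    hp hq hr (hcne 0 1 (by decide)) (hcne 1 2 (by decide)) (hcne 0 2 (by decide)) hpq hqr hrp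
    (hPP 0 1 (by decide)) (hPP 0 2 (by decide)) (hPP 1 2 (by decide)) (B := {u | u ∈ D.support})
    hv hsupp (hPc 0) (hPc 1) (hPc 2)
  have hPK : ∀ i, ∀ e ∈ (P i).edges, e ∈ K.edgeSet := by
    intro i e h
    rw [hKe]
    fin_cases i
    exacts [Or.inl h, Or.inr (Or.inl h), Or.inr (Or.inr (Or.inl h))]
  have hKs : ∀ i, K.Adj v (s i) := fun i => hPK i s(v, s i) (by simp [P])
  have hDK : ∀ e ∈ D.edges, e ∈ K.edgeSet := by
    intro e h
    rw [hKe]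
    rw [he] at h
    tauto
  refine ⟨K, ⟨_, hK⟩, hKs, ?_, hDK, ?_⟩
  · have hinj : Function.Injective s := fun i j hij => by
      by_contra hne
      exact hTT i j hne _ (T i).start_mem_support (by rw [hij]; exact (T j).start_mem_support)
    calc 3 = (Set.range s).ncard := by
          rw [← Set.image_univ, Set.ncard_image_of_injective _ hinj, Set.ncard_univ]
          simp
      _ ≤ _ := Set.ncard_le_ncard (by rintro _ ⟨i, rfl⟩; exact hKs i) (Set.toFinite _)
  · intro d' D' hD' hvD' hD'K
    have hmeet : ∀ i, ∀ u ∈ (P i).support, u ≠ c i → u ∉ D'.support := by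
      intro i
      refine SimpleGraph.Walk.notMem_support_cycle_of_ncard_neighborSet_le_two (hP i) (hPK i)
        (fun w hw hwv hwc => hK.ncard_neighborSet_le_two ?_) (fun w => Set.toFinite _) hD' hD'K hvD'
      have hwD : w ∉ D.support := fun h => hwc (hPc i w hw h)
      have hne : ∀ j, c j ≠ w := fun j h => hwD (h ▸ hc j)
      simpa [Fin.forall_fin_succ] using ⟨hwv.symm, hne 0, hne 1, hne 2⟩
    have hnot : ∀ i, ∀ e ∈ (P i).edges, e ∉ D'.edges := by
      rintro i ⟨a, b⟩ h h'
      have ha : a = c i := by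
        by_contra hne
        exact hmeet i a ((P i).fst_mem_support_of_mem_edges h) hne
          (D'.fst_mem_support_of_mem_edges h')
      have hb : b = c i := by
        by_contra hne
        exact hmeet i b ((P i).snd_mem_support_of_mem_edges h) hne
          (D'.snd_mem_support_of_mem_edges h')
      exact ((P i).adj_of_mem_edges h).ne (ha.trans hb.symm)
    intro e h
    rcases (hKe e).1 (hD'K e h) with h' | h' | h' | h'
    · exact absurd h (hnot 0 e h')
    · exact absurd h (hnot 1 e h')
    · exact absurd h (hnot 2 e h')
    · exact (he e).2 h'

lemma SimpleGraph.Walk.exists_isPath_to_first {B : Set V} {a b : V} (p : G.Walk a b)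
    (hp : p.IsPath) (hb : b ∈ B) : ∃ c ∈ B, ∃ q : G.Walk a c, q.IsPath ∧
      (∀ u ∈ q.support, u ∈ p.support) ∧ ∀ u ∈ q.support, u ∈ B → u = c := by
  induction p with
  | nil => exact ⟨_, hb, .nil, by simp, by simp, by simp⟩
  | @cons a a' b h p ih =>
    by_cases ha : a ∈ B
    · exact ⟨a, ha, .nil, by simp, by simp, by simp⟩
    rw [SimpleGraph.Walk.cons_isPath_iff] at hp
    obtain ⟨c, hc, q, hq, hqp, hqB⟩ := ih hp.1 hb
    refine ⟨c, hc, .cons h q, ?_, ?_, ?_⟩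
    · exact (SimpleGraph.Walk.cons_isPath_iff _ _).2 ⟨hq, fun h => hp.2 (hqp _ h)⟩
    · simp only [SimpleGraph.Walk.support_cons, List.mem_cons]
      exact fun u hu => hu.imp_right (hqp u)
    · simp only [SimpleGraph.Walk.support_cons, List.mem_cons]
      rintro u (rfl | hu) huB
      · exact absurd huB ha
      · exact hqB u hu huB

lemma SimpleGraph.Walk.exists_isPath_from_neighbor {B : Set V} {v a b : V} (p : G.Walk a b)
    (hp : p.IsPath) (hb : b ∈ B) (hv : v ∉ B) (ha : a = v ∨ G.Adj v a ∧ v ∉ p.support) :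
    ∃ a', (a ≠ v → a' = a) ∧ G.Adj v a' ∧ ∃ c ∈ B, ∃ q : G.Walk a' c, q.IsPath ∧
      v ∉ q.support ∧ (∀ u ∈ q.support, u ∈ p.support) ∧ ∀ u ∈ q.support, u ∈ B → u = c := by
  rcases ha with rfl | ⟨ha, hvp⟩
  · cases p with
    | nil => exact absurd hb hv
    | @cons _ z _ h p =>
      rw [SimpleGraph.Walk.cons_isPath_iff] at hp
      obtain ⟨c, hc, q, hq, hqp, hqB⟩ := p.exists_isPath_to_first hp.1 hb
      exact ⟨z, fun h => absurd rfl h, h, c, hc, q, hq, fun h => hp.2 (hqp _ h),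
        fun u hu => by simp [hqp u hu], hqB⟩
  · obtain ⟨c, hc, q, hq, hqp, hqB⟩ := p.exists_isPath_to_first hp hb
    exact ⟨a, fun _ => rfl, ha, c, hc, q, hq, fun h => hvp (hqp _ h), hqp, hqB⟩

lemma IsKConnected.exists_walk [Fintype V] {k : ℕ} (hG : IsKConnected k G) {S : Finset V}
    (hS : S.card < k) {a b : V} (ha : a ∉ S) (hb : b ∉ S) :
    ∃ p : G.Walk a b, p.IsPath ∧ ∀ u ∈ p.support, u ∉ S := by
  classical
  obtain ⟨p⟩ := (hG.2 S hS).preconnected ⟨a, by simpa using ha⟩ ⟨b, by simpa using hb⟩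
  let f : G.induce ((↑S : Set V)ᶜ) →g G := (SimpleGraph.Embedding.induce _).toHom
  have hp : ∀ u ∈ (p.map f).support, u ∉ S := by
    intro u hu
    rw [SimpleGraph.Walk.support_map, List.mem_map] at hu
    obtain ⟨w, -, rfl⟩ := hu
    exact w.2
  exact ⟨(p.map f).bypass, SimpleGraph.Walk.bypass_isPath _,
    fun u hu => hp u (SimpleGraph.Walk.support_bypass_subset_support _ hu)⟩

lemma IsKConnected.three_le_card_of_separates [Fintype V] (hG : IsKConnected 3 G) {v x y : V}
    (hvx : G.Adj v x) (hvy : G.Adj v y) (hxy : x ≠ y) {B : Finset V} (hB : 3 ≤ B.card)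
    (hv : v ∉ B) {S : Finset V}
    (hS : Separates (G.deleteEdges {s(v, x), s(v, y)}) {x, y, v} B S) : 3 ≤ S.card := by
  classical
  by_contra! hlt
  obtain ⟨c, hcB, hcS⟩ : ∃ c ∈ B, c ∉ S := by
    by_contra! h
    have := Finset.card_le_card (show B ⊆ S from h)
    omega
  have key : ∀ {a b : V} (p : G.Walk a b), v ∉ p.support →
      ∃ q : (G.deleteEdges {s(v, x), s(v, y)}).Walk a b, q.support = p.support := by
    intro a b p hp
    refine ⟨p.toDeleteEdges _ fun e he h => hp ?_, SimpleGraph.Walk.support_transfer _ _⟩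
    rcases h with rfl | rfl <;> exact p.fst_mem_support_of_mem_edges he
  have hno : ∀ a ∈ ({x, y} : Set V), ∀ p : G.Walk a c, v ∉ p.support →
      ¬ ∀ u ∈ p.support, u ∉ S := by
    intro a ha p hp h
    obtain ⟨q, hq⟩ := key p hp
    obtain ⟨s, hs, hsq⟩ := hS a (by simpa using Or.imp_right Or.inl ha) c hcB q
    exact h s (hq ▸ hsq) hs
  by_cases hvS : v ∈ S
  · obtain ⟨a, ha, haS⟩ : ∃ a ∈ ({x, y} : Set V), a ∉ S := by
      by_contra! h
      have hsub : ({v, x, y} : Finset V) ⊆ S := by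
        intro u hu
        simp only [Finset.mem_insert, Finset.mem_singleton] at hu
        rcases hu with rfl | rfl | rfl
        exacts [hvS, h _ (by simp), h _ (by simp)]
      have := Finset.card_le_card hsub
      rw [Finset.card_eq_three.2 ⟨v, x, y, hvx.ne, hvy.ne, hxy, rfl⟩] at this
      omega
    obtain ⟨p, -, hp⟩ := hG.exists_walk hlt haS hcS
    exact hno a ha p (fun h => hp v h hvS) hp
  · obtain ⟨p, hpath, hp⟩ := hG.exists_walk hlt hvS hcS
    cases p with
    | nil => exact hv hcB
    | @cons _ z _ h p =>
      rw [SimpleGraph.Walk.cons_isPath_iff] at hpath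
      have hp' : ∀ u ∈ p.support, u ∉ S := fun u hu => hp u (by simp [hu])
      by_cases hz : z ∈ ({x, y} : Set V)
      · exact hno z hz p hpath.2 hp'
      · obtain ⟨q, hq⟩ := key p hpath.2
        have hvz : (G.deleteEdges {s(v, x), s(v, y)}).Adj v z := by
          simp only [Set.mem_insert_iff, Set.mem_singleton_iff, not_or] at hz
          rw [SimpleGraph.deleteEdges_adj]
          refine ⟨h, ?_⟩
          rintro (h | h)
          · exact hz.1 (Sym2.congr_right.1 h)
          · exact hz.2 (Sym2.congr_right.1 h)
        obtain ⟨s, hs, hsq⟩ := hS v (by simp) c hcB (.cons hvz q)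
        rw [SimpleGraph.Walk.support_cons, hq, List.mem_cons] at hsq
        rcases hsq with rfl | hsq
        · exact hvS hs
        · exact hp' s hsq hs

/-- In a 3-connected graph, two edges at a vertex and a cycle avoiding that vertex extend to
a `K₄`-subdivision in which the cycle is determined by the vertex. -/
lemma IsKConnected.exists_isK4Subdivision [Fintype V] (hG : IsKConnected 3 G) {v x y d : V}
    (hvx : G.Adj v x) (hvy : G.Adj v y) (hxy : x ≠ y) {D : G.Walk d d} (hD : D.IsCycle)
    (hv : v ∉ D.support) :
    ∃ K : G.Subgraph, IsK4Subdivision K ∧ K.Adj v x ∧ K.Adj v y ∧ 3 ≤ (K.neighborSet v).ncard ∧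
      (∀ e ∈ D.edges, e ∈ K.edgeSet) ∧ ∀ (d' : V) (D' : G.Walk d' d'), D'.IsCycle →
        v ∉ D'.support → (∀ e ∈ D'.edges, e ∈ K.edgeSet) → ∀ e ∈ D'.edges, e ∈ D.edges := by
  classical
  have hB : 3 ≤ D.support.toFinset.card := by
    have h1 : D.support.tail.toFinset.card = D.length := by
      rw [List.toFinset_card_of_nodup hD.support_nodup]
      simp
    calc 3 ≤ D.length := hD.three_le_length
      _ = D.support.tail.toFinset.card := h1.symm
      _ ≤ _ := Finset.card_le_card fun u hu => by
        rw [List.mem_toFinset] at hu ⊢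
        exact List.mem_of_mem_tail hu
  obtain ⟨s, t, p, hs, ht, hp, hpp⟩ := linked_of_forall_separates
    (G.deleteEdges {s(v, x), s(v, y)}) {x, y, v} D.support.toFinset 3
    fun S hS => hG.three_le_card_of_separates hvx hvy hxy hB (by simpa using hv) hS
  have hle := G.deleteEdges_le {s(v, x), s(v, y)}
  obtain ⟨-, hsurj, -⟩ := eq_of_mem_of_disjoint (P := fun i => {u | u ∈ (p i).support})
    (fun i => (p i).start_mem_support) hpp (T := {x, y, v})
    (Finset.card_eq_three.2 ⟨x, y, v, hxy, hvx.ne', hvy.ne', rfl⟩) (fun i => by simpa using hs i)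
  obtain ⟨i₀, h₀⟩ := hsurj x (by simp)
  obtain ⟨i₁, h₁⟩ := hsurj y (by simp)
  obtain ⟨i₂, h₂⟩ := hsurj v (by simp)
  have key : ∀ i, ∃ a', (s i ≠ v → a' = s i) ∧ G.Adj v a' ∧ ∃ c ∈ {u | u ∈ D.support},
      ∃ q : G.Walk a' c, q.IsPath ∧ v ∉ q.support ∧ (∀ u ∈ q.support, u ∈ (p i).support) ∧
        ∀ u ∈ q.support, u ∈ {u | u ∈ D.support} → u = c := by
    intro i
    have h := ((p i).mapLe hle).exists_isPath_from_neighbor (B := {u | u ∈ D.support}) (v := v)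
      ((SimpleGraph.Walk.isPath_mapLe hle).2 (hp i)) (by simpa using ht i) hv
    rw [SimpleGraph.Walk.support_mapLe_eq_support] at h
    refine h (or_iff_not_imp_left.2 fun hsv => ⟨?_, fun hvi => ?_⟩)
    · have := hs i
      simp only [Set.mem_insert_iff, Set.mem_singleton_iff, hsv, or_false] at this
      rcases this with h | h <;> rw [h] <;> assumption
    · exact hpp i i₂ (by rintro rfl; exact hsv h₂) v hvi (h₂ ▸ (p i₂).start_mem_support)
  choose a ha hva c hc T hT hvT hTp hTc using key
  obtain ⟨K, hK, hKa, h⟩ := exists_isK4Subdivision_of_fan hD hv a c T hT hva hvT hc hTc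
    fun i j hij u hu hu' => hpp i j hij u (hTp i u hu) (hTp j u hu')
  refine ⟨K, hK, ?_, ?_, h⟩
  · have := hKa i₀
    rwa [ha i₀ (h₀ ▸ hvx.ne'), h₀] at this
  · have := hKa i₁
    rwa [ha i₁ (h₁ ▸ hvy.ne'), h₁] at this

end Fan

section Counting

variable [Fintype V] {G : SimpleGraph V}

lemma IsKConnected.exists_walk_deleteIncidenceSet (hG : IsKConnected 3 G) {v a b : V}
    {S : Finset V} (hS : S.card < 3) (hv : v ∈ S) (ha : a ∉ S) (hb : b ∉ S) :
    ∃ p : (G.deleteIncidenceSet v).Walk a b, ∀ u ∈ p.support, u ∉ S := by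
  obtain ⟨p, -, hp⟩ := hG.exists_walk hS ha hb
  have he : ∀ e ∈ p.edges, e ∈ (G.deleteIncidenceSet v).edgeSet := fun e he => by
    rw [SimpleGraph.edgeSet_deleteIncidenceSet]
    exact ⟨p.edges_subset_edgeSet he, fun h => hp v (p.mem_support_of_mem_edges he h.2) hv⟩
  exact ⟨p.transfer _ he, by rwa [SimpleGraph.Walk.support_transfer]⟩

lemma IsKConnected.choose_le_ncard_cycleEdgeSets (hG : IsKConnected 3 G) (v : V) :
    ((G.deleteIncidenceSet v).edgeSet.ncard - Fintype.card V + 1).choose 2 ≤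
      (cycleEdgeSets (G.deleteIncidenceSet v)).ncard := by
  classical
  refine _root_.choose_le_ncard_cycleEdgeSets (fun u x y hxy hux huy => ?_)
    fun a b ⟨x, hx⟩ ⟨y, hy⟩ => ?_
  · rw [SimpleGraph.deleteIncidenceSet_adj] at hux huy
    obtain ⟨p, hp⟩ := hG.exists_walk_deleteIncidenceSet (v := v) (a := x) (b := y)
      (S := {v, u})
      (Finset.card_le_two.trans_lt (by decide)) (by simp)
      (by simp [hux.2.2, hux.1.ne']) (by simp [huy.2.2, huy.1.ne'])
    exact ⟨p, fun h => hp u h (by simp)⟩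
  · rw [SimpleGraph.deleteIncidenceSet_adj] at hx hy
    obtain ⟨p, -⟩ := hG.exists_walk_deleteIncidenceSet (v := v) (S := {v}) (by simp) (by simp)
      (by simpa using hx.2.1) (by simpa using hy.2.1)
    exact ⟨p⟩

lemma IsKConnected.le_ncard_cycleEdgeSets (hG : IsKConnected 3 G)
    (hm : 3 * Fintype.card V < G.edgeSet.ncard) (v : V) :
    (G.edgeSet.ncard : ℝ) / 3 * ((G.edgeSet.ncard : ℝ) / 3 - 1) / 2 ≤
      ((cycleEdgeSets (G.deleteIncidenceSet v)).ncard : ℝ) := by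
  classical
  have hcard : (G.deleteIncidenceSet v).edgeSet.ncard = G.edgeSet.ncard - G.degree v := by
    have := G.card_edgeFinset_deleteIncidenceSet v
    rwa [SimpleGraph.edgeFinset, SimpleGraph.edgeFinset, ← Set.ncard_eq_toFinset_card',
      ← Set.ncard_eq_toFinset_card'] at this
  have hdeg := G.degree_lt_card_verts v
  have hle := hG.choose_le_ncard_cycleEdgeSets v
  have hn := hG.1
  obtain ⟨a, ha⟩ : ∃ a, a = (G.deleteIncidenceSet v).edgeSet.ncard - Fintype.card V + 1 :=
    ⟨_, rfl⟩
  rw [← ha] at hle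
  have ham : G.edgeSet.ncard ≤ 3 * a := by omega
  have hm3 : 3 ≤ G.edgeSet.ncard := by omega
  have hle' : ((a.choose 2 : ℕ) : ℝ) ≤ _ := Nat.cast_le.2 hle
  rw [Nat.cast_choose_two] at hle'
  have ham' : (G.edgeSet.ncard : ℝ) ≤ 3 * a := by exact_mod_cast ham
  have hm3' : (3 : ℝ) ≤ G.edgeSet.ncard := by exact_mod_cast hm3
  refine le_trans ?_ hle'
  have : (G.edgeSet.ncard : ℝ) / 3 * ((G.edgeSet.ncard : ℝ) / 3 - 1) ≤ a * (a - 1) :=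
    mul_le_mul (by linarith) (by linarith) (by linarith) (by linarith)
  linarith

lemma IsKConnected.exists_isK4Subdivision_of_mem_cycleEdgeSets (hG : IsKConnected 3 G)
    {v x y : V} (hvx : G.Adj v x) (hvy : G.Adj v y) (hxy : x ≠ y) {C : Set (Sym2 V)}
    (hC : C ∈ cycleEdgeSets (G.deleteIncidenceSet v)) :
    ∃ K : G.Subgraph, IsK4Subdivision K ∧ K.Adj v x ∧ K.Adj v y ∧ 3 ≤ (K.neighborSet v).ncard ∧
      C ⊆ K.edgeSet ∧ ∀ C' ∈ cycleEdgeSets (G.deleteIncidenceSet v), C' ⊆ K.edgeSet → C' ⊆ C := by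
  have hle := G.deleteIncidenceSet_le v
  have hmap : ∀ {d : V} {D : (G.deleteIncidenceSet v).Walk d d}, D.IsCycle →
      (D.mapLe hle).IsCycle ∧ v ∉ (D.mapLe hle).support := by
    intro d D hD
    refine ⟨(SimpleGraph.Walk.isCycle_mapLe hle).2 hD, ?_⟩
    rw [SimpleGraph.Walk.support_mapLe_eq_support]
    intro h
    obtain ⟨e, he, hve⟩ := (D.mem_support_iff_exists_mem_edges_of_not_nil hD.not_nil).1 h
    exact (G.edgeSet_deleteIncidenceSet v ▸ D.edges_subset_edgeSet he).2
      ⟨SimpleGraph.edgeSet_mono hle (D.edges_subset_edgeSet he), hve⟩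
  obtain ⟨d, D, hD, rfl⟩ := hC
  obtain ⟨K, hK, hKx, hKy, h3, hDK, hcyc⟩ :=
    hG.exists_isK4Subdivision hvx hvy hxy (hmap hD).1 (hmap hD).2
  simp only [SimpleGraph.Walk.edges_mapLe_eq_edges] at hDK hcyc
  refine ⟨K, hK, hKx, hKy, h3, hDK, ?_⟩
  rintro _ ⟨d', D', hD', rfl⟩ h
  have := hcyc d' (D'.mapLe hle) (hmap hD').1 (hmap hD').2
  rw [SimpleGraph.Walk.edges_mapLe_eq_edges] at this
  exact this h

lemma IsKConnected.sum_le_ncard_isK4Subdivision (hG : IsKConnected 3 G) [DecidableRel G.Adj] :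
    ∑ v, (G.degree v * G.degree v - G.degree v) *
        (cycleEdgeSets (G.deleteIncidenceSet v)).ncard ≤
      24 * {K : G.Subgraph | IsK4Subdivision K}.ncard := by
  classical
  let I : Finset (Σ _ : V, (V × V) × Set (Sym2 V)) := Finset.univ.sigma fun v =>
    (G.neighborFinset v).offDiag ×ˢ (cycleEdgeSets (G.deleteIncidenceSet v)).toFinset
  have hI : I.card = ∑ v, (G.degree v * G.degree v - G.degree v) *
      (cycleEdgeSets (G.deleteIncidenceSet v)).ncard := by
    simp [I, Finset.card_sigma, Finset.card_product, Finset.offDiag_card,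
      Set.ncard_eq_toFinset_card']
  have hK : ∀ t ∈ I, ∃ K : G.Subgraph, IsK4Subdivision K ∧ K.Adj t.1 t.2.1.1 ∧
      K.Adj t.1 t.2.1.2 ∧ 3 ≤ (K.neighborSet t.1).ncard ∧ t.2.2 ⊆ K.edgeSet ∧
      ∀ C' ∈ cycleEdgeSets (G.deleteIncidenceSet t.1), C' ⊆ K.edgeSet → C' ⊆ t.2.2 := by
    rintro ⟨v, ⟨x, y⟩, C⟩ ht
    simp only [I, Finset.mem_sigma, Finset.mem_univ, true_and, Finset.mem_product,
      Finset.mem_offDiag, SimpleGraph.mem_neighborFinset, Set.mem_toFinset] at ht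
    obtain ⟨⟨hx, hy, hxy⟩, hC⟩ := ht
    exact hG.exists_isK4Subdivision_of_mem_cycleEdgeSets hx hy hxy hC
  choose! K hK using hK
  rw [← hI, Set.ncard_eq_toFinset_card']
  refine Finset.card_le_mul_card_image_of_maps_to (f := K)
    (fun t ht => by simpa using (hK t ht).1) 24 fun L hL => ?_
  obtain ⟨b, hb⟩ : IsK4Subdivision L := by simpa using hL
  let R : Finset (V × V × V) := (Finset.univ.image b).biUnion fun v =>
    {v} ×ˢ (L.neighborSet v).toFinset.offDiag
  have hR : R.card ≤ 4 * 6 := by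
    refine (Finset.card_biUnion_le_card_mul _ _ 6 fun v hv => ?_).trans
      (Nat.mul_le_mul_right 6 (by simpa using Finset.card_image_le (s := .univ) (f := b)))
    obtain ⟨i, -, rfl⟩ := Finset.mem_image.1 hv
    have h := hb.ncard_neighborSet_branch_le_three i
    rw [Set.ncard_eq_toFinset_card'] at h
    rw [Finset.card_product, Finset.card_singleton, Finset.offDiag_card]
    interval_cases (L.neighborSet (b i)).toFinset.card <;> decide
  refine (Finset.card_le_card_of_injOn (t := R) (fun t => (t.1, t.2.1)) ?_ ?_).trans hR
  · rintro ⟨v, ⟨x, y⟩, C⟩ ht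
    obtain ⟨htI, rfl⟩ := Finset.mem_filter.1 ht
    obtain ⟨-, hx, hy, h3, -⟩ := hK _ htI
    obtain ⟨i, hi⟩ := hb.exists_eq_of_three_le h3
    have hxy : x ≠ y := by
      simp only [I, Finset.mem_sigma, Finset.mem_product, Finset.mem_offDiag] at htI
      exact htI.2.1.2.2
    simp only [R, Finset.coe_biUnion, Set.mem_iUnion, Finset.mem_coe, Finset.mem_product,
      Finset.mem_singleton, Finset.mem_offDiag, Set.mem_toFinset]
    exact ⟨v, Finset.mem_image.2 ⟨i, Finset.mem_univ _, hi⟩, rfl, hx, hy, hxy⟩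
  · rintro ⟨v, xy, C⟩ ht ⟨v', xy', C'⟩ ht' h
    obtain ⟨rfl, rfl⟩ := Prod.mk.inj h
    obtain ⟨htI, htL⟩ := Finset.mem_filter.1 ht
    obtain ⟨htI', htL'⟩ := Finset.mem_filter.1 ht'
    obtain ⟨-, -, -, -, hC, hmax⟩ := hK _ htI
    obtain ⟨-, -, -, -, hC', hmax'⟩ := hK _ htI'
    rw [htL] at hC hmax
    rw [htL'] at hC' hmax'
    simp only [I, Finset.mem_sigma, Finset.mem_product, Set.mem_toFinset] at htI htI'
    rw [(hmax' C htI.2.2 hC).antisymm (hmax C' htI'.2.2 hC')]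

end Counting

/-- Let `G` be a 3-connected graph with `n` vertices and `m` edges with
`m > 3n`. Then the number of distinct `K₄`-subdivisions of `G` is at least
`(m/6) ((m/3)(m/3 - 1)/2) (m/n - 1/2)`, evaluated over the reals. -/
theorem stmt14 [Fintype V] {G : SimpleGraph V} (hG : IsKConnected 3 G)
    (hm : 3 * Fintype.card V < G.edgeSet.ncard) :
    (G.edgeSet.ncard : ℝ) / 6 *
        ((G.edgeSet.ncard : ℝ) / 3 * ((G.edgeSet.ncard : ℝ) / 3 - 1) / 2) *
        ((G.edgeSet.ncard : ℝ) / (Fintype.card V : ℝ) - 1 / 2) ≤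
      ({H : G.Subgraph | IsK4Subdivision H}.ncard : ℝ) := by
  classical
  have hcyc := hG.le_ncard_cycleEdgeSets hm
  have hsum : ∑ v, ((G.degree v : ℝ) ^ 2 - G.degree v) *
      ((cycleEdgeSets (G.deleteIncidenceSet v)).ncard : ℝ) ≤
        24 * ({H : G.Subgraph | IsK4Subdivision H}.ncard : ℝ) := by
    refine le_of_eq_of_le ?_ (Nat.cast_le (α := ℝ).2 hG.sum_le_ncard_isK4Subdivision) |>.trans_eq
      (by push_cast; rfl)
    rw [Nat.cast_sum]
    refine Finset.sum_congr rfl fun v _ => ?_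
    rw [Nat.cast_mul, Nat.cast_sub (Nat.le_mul_self _), Nat.cast_mul, sq]
  have hdeg : ∑ v, (G.degree v : ℝ) = 2 * G.edgeSet.ncard := by
    have := G.sum_degrees_eq_twice_card_edges
    rw [SimpleGraph.edgeFinset, ← Set.ncard_eq_toFinset_card'] at this
    exact_mod_cast this
  have hsq : (∑ v, (G.degree v : ℝ)) ^ 2 ≤ Fintype.card V * ∑ v, (G.degree v : ℝ) ^ 2 :=
    sq_sum_le_card_mul_sum_sq
  have hm3 : (3 : ℝ) ≤ G.edgeSet.ncard := by
    have := hG.1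
    exact_mod_cast (by omega : 3 ≤ G.edgeSet.ncard)
  have hn : (0 : ℝ) < Fintype.card V := by exact_mod_cast (Nat.zero_lt_of_lt hG.1)
  set m : ℝ := (G.edgeSet.ncard : ℝ)
  set n : ℝ := (Fintype.card V : ℝ)
  set c : ℝ := m / 3 * (m / 3 - 1) / 2 with hc_def
  have hc : 0 ≤ c :=
    div_nonneg (mul_nonneg (by linarith) (by linarith)) (by norm_num)
  have hlow : (∑ v, ((G.degree v : ℝ) ^ 2 - G.degree v)) * c ≤
      24 * ({H : G.Subgraph | IsK4Subdivision H}.ncard : ℝ) := by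
    refine le_trans ?_ hsum
    rw [Finset.sum_mul]
    refine Finset.sum_le_sum fun v _ => mul_le_mul_of_nonneg_left (hcyc v) ?_
    have : G.degree v ≤ G.degree v ^ 2 := Nat.le_self_pow two_ne_zero _
    rw [sub_nonneg]
    exact_mod_cast this
  rw [Finset.sum_sub_distrib, hdeg] at hlow
  rw [hdeg] at hsq
  have hsq' : (2 * m) ^ 2 / n ≤ ∑ v, (G.degree v : ℝ) ^ 2 := (div_le_iff₀' hn).2 hsq
  have hmul := mul_le_mul_of_nonneg_right (sub_le_sub_right hsq' (2 * m)) hc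
  have heq : m / 6 * c * (m / n - 1 / 2) = ((2 * m) ^ 2 / n - 2 * m) * c / 24 := by ring
  rw [heq]
  linarith
end

section
/- Every 3-connected graph contains a subgraph that is a K4-subdivision. -/
open SimpleGraph

variable {V : Type*}

namespace SimpleGraph.Walk

/-- A path meeting a set splits at the first vertex it has in that set. -/
theorem IsPath.exists_split {G : SimpleGraph V} {u w : V} {P : G.Walk u w} (hP : P.IsPath)
    {S : Set V} (hS : ∃ x ∈ P.support, x ∈ S) :
    ∃ a ∈ S, ∃ (P₁ : G.Walk u a) (P₂ : G.Walk a w), P₁.IsPath ∧ P₂.IsPath ∧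
      (∀ x, x ∈ P.support ↔ x ∈ P₁.support ∨ x ∈ P₂.support) ∧
      (∀ x ∈ P₁.support, x ∈ P₂.support → x = a) ∧
      (∀ x ∈ P₁.support, x ∈ S → x = a) := by
  induction P with
  | nil =>
    obtain ⟨x, hx, hxS⟩ := hS
    simp only [support_nil, List.mem_singleton] at hx
    subst hx
    exact ⟨x, hxS, Walk.nil, Walk.nil, by simp⟩
  | @cons u v w h p ih =>
    by_cases huS : u ∈ S
    · exact ⟨u, huS, Walk.nil, cons h p, by simp, hP, by simp, by simp, by simp⟩
    · rw [cons_isPath_iff] at hP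
      obtain ⟨a, haS, P₁, P₂, h₁, h₂, hsupp, hint, hfirst⟩ := ih hP.1 (by
        obtain ⟨x, hx, hxS⟩ := hS
        rw [support_cons, List.mem_cons] at hx
        exact ⟨x, by grind, hxS⟩)
      refine ⟨a, haS, cons h P₁, P₂, ?_, h₂, ?_, ?_, ?_⟩
      · rw [cons_isPath_iff]
        grind
      all_goals
        simp only [support_cons, List.mem_cons]
        grind

end SimpleGraph.Walk

/-- Six internally disjoint paths between four distinct vertices form a `K₄`-subdivision. -/
theorem exists_isK4Subdivision_of_paths {G : SimpleGraph V} {a b c d : V}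
    (hab : a ≠ b) (hac : a ≠ c) (had : a ≠ d) (hbc : b ≠ c) (hbd : b ≠ d) (hcd : c ≠ d)
    {P₀₁ : G.Walk a b} {P₀₂ : G.Walk a c} {P₀₃ : G.Walk a d}
    {P₁₂ : G.Walk b c} {P₁₃ : G.Walk b d} {P₂₃ : G.Walk c d}
    (h₀₁ : P₀₁.IsPath) (h₀₂ : P₀₂.IsPath) (h₀₃ : P₀₃.IsPath)
    (h₁₂ : P₁₂.IsPath) (h₁₃ : P₁₃.IsPath) (h₂₃ : P₂₃.IsPath)
    (h₀₁₀₂ : ∀ x ∈ P₀₁.support, x ∈ P₀₂.support → x = a)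
    (h₀₁₀₃ : ∀ x ∈ P₀₁.support, x ∈ P₀₃.support → x = a)
    (h₀₁₁₂ : ∀ x ∈ P₀₁.support, x ∈ P₁₂.support → x = b)
    (h₀₁₁₃ : ∀ x ∈ P₀₁.support, x ∈ P₁₃.support → x = b)
    (h₀₁₂₃ : ∀ x ∈ P₀₁.support, x ∉ P₂₃.support)
    (h₀₂₀₃ : ∀ x ∈ P₀₂.support, x ∈ P₀₃.support → x = a)
    (h₀₂₁₂ : ∀ x ∈ P₀₂.support, x ∈ P₁₂.support → x = c)
    (h₀₂₁₃ : ∀ x ∈ P₀₂.support, x ∉ P₁₃.support)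
    (h₀₂₂₃ : ∀ x ∈ P₀₂.support, x ∈ P₂₃.support → x = c)
    (h₀₃₁₂ : ∀ x ∈ P₀₃.support, x ∉ P₁₂.support)
    (h₀₃₁₃ : ∀ x ∈ P₀₃.support, x ∈ P₁₃.support → x = d)
    (h₀₃₂₃ : ∀ x ∈ P₀₃.support, x ∈ P₂₃.support → x = d)
    (h₁₂₁₃ : ∀ x ∈ P₁₂.support, x ∈ P₁₃.support → x = b)
    (h₁₂₂₃ : ∀ x ∈ P₁₂.support, x ∈ P₂₃.support → x = c)
    (h₁₃₂₃ : ∀ x ∈ P₁₃.support, x ∈ P₂₃.support → x = d) :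
    ∃ H : G.Subgraph, IsK4Subdivision H := by
  have hinj : Function.Injective ![a, b, c, d] := by
    intro i j
    fin_cases i <;> fin_cases j <;> first
      | exact fun _ => rfl
      | exact fun h => absurd h (by assumption)
      | exact fun h => absurd h.symm (by assumption)
  let s : Fin 4 × Fin 4 → List V := fun p =>
    ![![[], P₀₁.support, P₀₂.support, P₀₃.support], ![[], [], P₁₂.support, P₁₃.support],
      ![[], [], [], P₂₃.support], ![[], [], [], []]] p.1 p.2
  have hex : ∀ p : Fin 4 × Fin 4, p.1 < p.2 →
      ∃ W : G.Walk (![a, b, c, d] p.1) (![a, b, c, d] p.2), W.IsPath ∧ W.support = s p := by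
    rintro ⟨i, j⟩ hij
    fin_cases i <;> fin_cases j <;> first
      | exact absurd hij (by decide)
      | exact ⟨P₀₁, h₀₁, rfl⟩
      | exact ⟨P₀₂, h₀₂, rfl⟩
      | exact ⟨P₀₃, h₀₃, rfl⟩
      | exact ⟨P₁₂, h₁₂, rfl⟩
      | exact ⟨P₁₃, h₁₃, rfl⟩
      | exact ⟨P₂₃, h₂₃, rfl⟩
  have hdisj : ∀ p q : Fin 4 × Fin 4, p.1 < p.2 → q.1 < q.2 → p ≠ q → ∀ x ∈ s p, x ∈ s q →
      x ∈ ({![a, b, c, d] p.1, ![a, b, c, d] p.2} ∩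
        {![a, b, c, d] q.1, ![a, b, c, d] q.2} : Set V) := by
    rintro ⟨i, j⟩ ⟨k, l⟩ hij hkl hne x
    fin_cases i <;> fin_cases j <;> first
      | exact absurd hij (by decide)
      | fin_cases k <;> fin_cases l <;> first
        | exact absurd hkl (by decide)
        | exact absurd rfl hne
        | simp [s]
          grind
  choose P hP hs using hex
  refine ⟨_, ![a, b, c, d], hinj, P, hP, ?_, rfl, ?_⟩
  · intro p h
    rw [← Walk.not_nil_iff_lt_length]
    intro hnil
    exact h.ne (hinj hnil.eq)
  · intro p q hp hq hpq x hx hy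
    rw [hs] at hx hy
    exact hdisj p q hp hq hpq x hx hy

/-- A connected set outside a cycle with at least three attachments on the cycle yields a
`K₄`-subdivision. The cycle is given as a path `P` together with an edge joining its ends, and
the set as a set of vertices linked pairwise by walks avoiding `P`. -/
theorem exists_isK4Subdivision_of_cycle {G : SimpleGraph V} {u w : V} {P : G.Walk u w}
    (hP : P.IsPath) (hwu : G.Adj w u) {K : Set V}
    (hK : ∀ x ∈ K, ∀ y ∈ K, ∃ W : G.Walk x y, ∀ z ∈ W.support, z ∉ P.support)
    {A : Finset V} (hA : 2 < A.card) (hAP : ∀ x ∈ A, x ∈ P.support)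
    (hAK : ∀ x ∈ A, ∃ y ∈ K, G.Adj x y) :
    ∃ H : G.Subgraph, IsK4Subdivision H := by
  classical
  have hpath : ∀ x ∈ K, ∀ y ∈ K, ∃ W : G.Walk x y, W.IsPath ∧ ∀ z ∈ W.support, z ∉ P.support := by
    intro x hx y hy
    obtain ⟨W, hW⟩ := hK x hx y hy
    exact ⟨W.bypass, W.bypass_isPath, fun z hz => hW z (W.support_bypass_subset_support hz)⟩
  obtain ⟨a₀, ha₀⟩ : A.Nonempty := Finset.card_pos.1 (by omega)
  obtain ⟨a, ha, P₁, T₁, hP₁, hT₁, hs₁, hi₁, hf₁⟩ :=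
    hP.exists_split (S := (A : Set V)) ⟨a₀, hAP _ ha₀, ha₀⟩
  obtain ⟨b₀, hb₀⟩ : (A.erase a).Nonempty := Finset.card_pos.1 (by
    rw [Finset.card_erase_of_mem ha]; omega)
  obtain ⟨b, hb, P₂, T₂, hP₂, hT₂, hs₂, hi₂, hf₂⟩ :=
    hT₁.exists_split (S := (A.erase a : Finset V)) ⟨b₀, by
      have := hAP b₀; have := hs₁ b₀; have := hf₁ b₀; grind, hb₀⟩
  obtain ⟨c₀, hc₀⟩ : ((A.erase a).erase b).Nonempty := Finset.card_pos.1 (by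
    rw [Finset.card_erase_of_mem hb, Finset.card_erase_of_mem ha]; omega)
  obtain ⟨c, hc, P₃, P₄, hP₃, hP₄, hs₃, hi₃, hf₃⟩ :=
    hT₂.exists_split (S := ((A.erase a).erase b : Finset V)) ⟨c₀, by
      have := hAP c₀; have := hs₁ c₀; have := hf₁ c₀; have := hs₂ c₀; have := hf₂ c₀
      grind, hc₀⟩
  simp only [Finset.coe_erase, Set.mem_sdiff, Set.mem_singleton_iff, Finset.mem_coe] at ha hb hc
  obtain ⟨⟨hcA, hca⟩, hcb⟩ := hc
  obtain ⟨hbA, hba⟩ := hb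
  obtain ⟨a', ha'K, haa'⟩ := hAK a ha
  obtain ⟨b', hb'K, hbb'⟩ := hAK b hbA
  obtain ⟨c', hc'K, hcc'⟩ := hAK c hcA
  obtain ⟨Q, hQ, hQP⟩ := hpath a' ha'K b' hb'K
  obtain ⟨R, hR, hRP⟩ := hpath c' hc'K a' ha'K
  obtain ⟨d, hd, R₁, R₂, hR₁, -, hsR, -, hfR⟩ :=
    hR.exists_split (S := {x | x ∈ Q.support}) ⟨a', by simp, by simp⟩
  obtain ⟨d', rfl, Q₁, Q₂, hQ₁, hQ₂, hsQ, hiQ, -⟩ :=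
    hQ.exists_split (S := {d}) ⟨d, hd, rfl⟩
  have haP := hAP a ha
  have hbP := hAP b hbA
  have hcP := hAP c hcA
  have ha₁ := P₁.end_mem_support
  have ha₂ := P₂.start_mem_support
  have hb₂ := P₂.end_mem_support
  have hb₃ := P₃.start_mem_support
  have hc₃ := P₃.end_mem_support
  have hc₄ := P₄.start_mem_support
  have hdQ₁ := Q₁.end_mem_support
  have hdQ₂ := Q₂.start_mem_support
  have hdR := R₁.end_mem_support
  have hdP := hQP d' hd
  have h₁₄ : ∀ x ∈ P₁.support, x ∉ P₄.support := by
    grind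
  have harc : (P₁.reverse.append (Walk.cons hwu.symm P₄.reverse)).IsPath := by
    have hcons : (Walk.cons hwu.symm P₄.reverse).IsPath :=
      (Walk.cons_isPath_iff _ _).2 ⟨hP₄.reverse, by
        simpa using h₁₄ u P₁.start_mem_support⟩
    rw [Walk.isPath_def, Walk.support_append, Walk.support_cons, List.tail_cons, List.nodup_append]
    refine ⟨hP₁.reverse.support_nodup, hP₄.reverse.support_nodup, ?_⟩
    simp only [Walk.support_reverse, List.mem_reverse]
    grind
  have hsarc : ∀ x, x ∈ (P₁.reverse.append (Walk.cons hwu.symm P₄.reverse)).support ↔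
      x ∈ P₁.support ∨ x ∈ P₄.support := by
    intro x
    have := P₁.start_mem_support
    simp only [Walk.mem_support_append_iff, Walk.support_cons, Walk.support_reverse,
      List.mem_reverse, List.mem_cons]
    grind
  refine exists_isK4Subdivision_of_paths (d := d') (P₀₁ := P₂)
    (P₀₂ := P₁.reverse.append (Walk.cons hwu.symm P₄.reverse)) (P₀₃ := Walk.cons haa' Q₁)
    (P₁₂ := P₃) (P₁₃ := Walk.cons hbb' Q₂.reverse) (P₂₃ := Walk.cons hcc' R₁)
    (Ne.symm hba) (Ne.symm hca) (fun h => hdP (h ▸ haP)) (Ne.symm hcb) (fun h => hdP (h ▸ hbP))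
    (fun h => hdP (h ▸ hcP)) hP₂ harc ?_ hP₃ ?_ ?_ ?_ ?_ ?_ ?_ ?_ ?_ ?_ ?_ ?_ ?_ ?_ ?_ ?_ ?_ ?_
  all_goals
    simp only [Walk.cons_isPath_iff, Walk.isPath_reverse_iff, hsarc, Walk.support_cons,
      Walk.support_reverse, List.mem_reverse, List.mem_cons, Set.mem_ofPred_eq] at *
    grind

theorem IsKConnected.exists_walk_s17 [Fintype V] {G : SimpleGraph V} {k : ℕ} (hG : IsKConnected k G)
    {S : Finset V} (hS : S.card < k) {x y : V} (hx : x ∉ S) (hy : y ∉ S) :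
    ∃ W : G.Walk x y, ∀ z ∈ W.support, z ∉ S := by
  obtain ⟨W⟩ := (hG.2 S hS).preconnected ⟨x, by simpa⟩ ⟨y, by simpa⟩
  refine ⟨W.map (Embedding.induce _).toHom, fun z hz => ?_⟩
  replace hz := Walk.support_map _ W ▸ hz
  rw [List.mem_map] at hz
  obtain ⟨z', -, rfl⟩ := hz
  exact fun h => z'.2 (Finset.mem_coe.2 h)

theorem IsKConnected.le_card_of_forall_mem_iff_adj [Fintype V] {G : SimpleGraph V} {k : ℕ}
    (hG : IsKConnected k G) (u : V) {N : Finset V} (hN : ∀ x, x ∈ N ↔ G.Adj u x) :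
    k ≤ N.card := by
  classical
  by_contra! hlt
  obtain ⟨y, hy⟩ : ∃ y, y ∉ insert u N := by
    by_contra! h
    have h₁ := Finset.card_le_card (fun y _ => h y : Finset.univ ⊆ insert u N)
    have h₂ := Finset.card_insert_le u N
    have h₃ := hG.1
    rw [Finset.card_univ] at h₁
    omega
  rw [Finset.mem_insert, not_or] at hy
  obtain ⟨W, hW⟩ := hG.exists_walk_s17 hlt (fun h => G.irrefl ((hN u).1 h)) hy.2
  cases W with
  | nil => exact hy.1 rfl
  | cons h p => exact hW _ (by simp) ((hN _).2 h)

/-- Every 3-connected graph contains a subgraph that is a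
`K₄`-subdivision. -/
theorem stmt17 [Fintype V] {G : SimpleGraph V} (hG : IsKConnected 3 G) :
    ∃ H : G.Subgraph, IsK4Subdivision H := by
  classical
  obtain ⟨u⟩ : Nonempty V := Fintype.card_pos_iff.1 (by have := hG.1; omega)
  obtain ⟨v, w, x, hv, hw, hx, hvw, hvx, hwx⟩ := Finset.two_lt_card_iff.1
    (hG.le_card_of_forall_mem_iff_adj u (N := G.neighborFinset u) (by simp))
  rw [mem_neighborFinset] at hv hw hx
  obtain ⟨W, hW⟩ := hG.exists_walk_s17 (S := {u, v}) (x := x) (y := w)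
    (Finset.card_le_two.trans_lt (by norm_num)) (by simp [hx.ne', hvx.symm])
    (by simp [hw.ne', hvw.symm])
  have huW : u ∉ W.bypass.support := fun h => by
    simpa using hW u (W.support_bypass_subset_support h)
  have hvW : v ∉ W.bypass.support := fun h => by
    simpa using hW v (W.support_bypass_subset_support h)
  let P : G.Walk u w := Walk.cons hx W.bypass
  have hP : P.IsPath := (Walk.cons_isPath_iff _ _).2 ⟨W.bypass_isPath, huW⟩
  have hvP : v ∉ P.support := by simp [P, hv.ne', hvW]
  let K : Set V := {y | ∃ W : G.Walk v y, ∀ z ∈ W.support, z ∉ P.support}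
  have hvK : v ∈ K := ⟨Walk.nil, by simpa using hvP⟩
  let A : Finset V := {a ∈ P.support.toFinset | ∃ y ∈ K, G.Adj a y}
  refine exists_isK4Subdivision_of_cycle hP hw.symm (K := K) (A := A) ?_ ?_
    (fun a ha => List.mem_toFinset.1 (Finset.mem_filter.1 ha).1)
    (fun a ha => (Finset.mem_filter.1 ha).2)
  · rintro y ⟨W₁, h₁⟩ z ⟨W₂, h₂⟩
    refine ⟨W₁.reverse.append W₂, fun t ht => ?_⟩
    rw [Walk.mem_support_append_iff, Walk.support_reverse, List.mem_reverse] at ht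
    exact ht.elim (h₁ t) (h₂ t)
  · by_contra! hle
    have hcard : 2 < ({u, w, x} : Finset V).card := by
      rw [Finset.card_eq_three.2 ⟨u, w, x, hw.ne, hx.ne, hwx, rfl⟩]; norm_num
    obtain ⟨p, hp, hpA⟩ := Finset.exists_mem_notMem_of_card_lt_card (hle.trans_lt hcard)
    have hpP : p ∈ P.support := by
      simp only [Finset.mem_insert, Finset.mem_singleton] at hp
      rcases hp with rfl | rfl | rfl <;> simp [P]
    obtain ⟨W', hW'⟩ := hG.exists_walk_s17 (S := A) (by omega) (x := v) (y := p)
      (by simp [A, hvP]) hpA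
    have hstay : ∀ {y z : V} (W : G.Walk y z), (∀ t ∈ W.support, t ∉ A) → y ∈ K → z ∈ K := by
      intro y z W
      induction W with
      | nil => exact fun _ h => h
      | @cons y t z h q ih =>
        intro hA hy
        rw [Walk.support_cons, List.forall_mem_cons] at hA
        refine ih hA.2 ?_
        have htA := hA.2 t q.start_mem_support
        have htP : t ∉ P.support := fun ht => htA (by
          simpa [A, ht] using ⟨y, hy, h.symm⟩)
        obtain ⟨W₁, h₁⟩ := hy
        refine ⟨W₁.concat h, fun r hr => ?_⟩
        rw [Walk.support_concat, List.mem_append, List.mem_singleton] at hr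
        rcases hr with hr | rfl
        exacts [h₁ r hr, htP]
    obtain ⟨W₁, h₁⟩ := hstay W' hW' hvK
    exact h₁ p W₁.end_mem_support hpP
end
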